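/- Let Ω ⊆ ℝ² be a nonempty bounded open set, let 2 < p < ∞, and let λ < λ_p. Then the supremum of ∫_Ω e^{4π u(x)²} dx over all u ∈ C_c^∞(Ω) with ∫_Ω |∇u(x)|² dx − λ (∫_Ω |u(x)|^p dx)^{2/p} ≤ 1 is finite. -/

import Mathlib

open MeasureTheory Real Set Filter
open scoped ENNReal

noncomputable section

abbrev E2 := EuclideanSpace ℝ (Fin 2)

/-- `u ∈ C_c^∞(Ω)`: smooth with compact support contained in `Ω`. -/
def IsTestFun (Ω : Set E2) (u : E2 → ℝ) : Prop :=
  ContDiff ℝ (⊤ : ℕ∞) u ∧ IsCompact (tsupport u) ∧ tsupport u ⊆ Ω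

/-- `Ω*`: the open disk centered at the origin with the same area as `Ω`. -/
def symDisk (Ω : Set E2) : Set E2 := Metric.ball 0 (Real.sqrt ((volume Ω).toReal / π))

/-- `λ_p`: the infimum of `∫_{Ω*} |∇u|²` over `u ∈ C_c^∞(Ω*)` with `‖u‖_{L^p(Ω*)} = 1`. -/
def lambdaP (Ω : Set E2) (p : ℝ) : ℝ :=
  sInf {c : ℝ | ∃ u : E2 → ℝ, IsTestFun (symDisk Ω) u ∧
    (∫ x in symDisk Ω, |u x| ^ p) ^ (1 / p) = 1 ∧
    c = ∫ x in symDisk Ω, ‖fderiv ℝ u x‖ ^ 2}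

section BrunnMinkowski

open scoped Pointwise Topology

theorem volume_add_le_volume_add_of_isCompact {K L : Set ℝ} (hK : IsCompact K) (hL : IsCompact L)
    (hK0 : K.Nonempty) (hL0 : L.Nonempty) : volume K + volume L ≤ volume (K + L) := by
  obtain ⟨k, hk, hkmax⟩ := hK.exists_isMaxOn hK0 continuousOn_id
  obtain ⟨l, hl, hlmin⟩ := hL.exists_isMinOn hL0 continuousOn_id
  have h1 : volume ((fun x => l + x) '' K) = volume K := by
    rw [image_add_left, measure_preimage_add]
  have h2 : volume ((fun x => k + x) '' L) = volume L := by
    rw [image_add_left, measure_preimage_add]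
  have hd : AEDisjoint volume ((fun x => l + x) '' K) ((fun x => k + x) '' L) := by
    refine measure_mono_null (t := {k + l}) ?_ (by simp)
    rintro _ ⟨⟨x, hx, rfl⟩, ⟨y, hy, hxy⟩⟩
    have h3 : x ≤ k := hkmax hx
    have h4 : l ≤ y := hlmin hy
    simp only [mem_singleton_iff] at *
    linarith
  rw [← h1, ← h2, ← measure_union₀ ?_ hd]
  · apply measure_mono
    rintro _ (⟨x, hx, rfl⟩ | ⟨x, hx, rfl⟩)
    · exact ⟨x, hx, l, hl, add_comm _ _⟩
    · exact ⟨k, hk, x, hx, rfl⟩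
  · exact ((hL.image (by fun_prop)).measurableSet).nullMeasurableSet

/-- The one-dimensional Brunn-Minkowski inequality. -/
theorem volume_add_le_volume_add {A B : Set ℝ} (hA : MeasurableSet A) (hB : MeasurableSet B)
    (hA0 : A.Nonempty) (hB0 : B.Nonempty) : volume A + volume B ≤ volume (A + B) := by
  rw [hA.measure_eq_iSup_isCompact, hB.measure_eq_iSup_isCompact]
  simp only [iSup_and']
  obtain ⟨a, ha⟩ := hA0
  obtain ⟨b, hb⟩ := hB0
  refine ENNReal.biSup_add_biSup_le' ⟨∅, by simp⟩ ⟨∅, by simp⟩ ?_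
  rintro K ⟨hKA, hK⟩ L ⟨hLB, hL⟩
  calc volume K + volume L ≤ volume (insert a K) + volume (insert b L) := by
        gcongr <;> exact subset_insert _ _
    _ ≤ volume (insert a K + insert b L) :=
        volume_add_le_volume_add_of_isCompact (hK.insert a) (hL.insert b) (insert_nonempty _ _)
          (insert_nonempty _ _)
    _ ≤ volume (A + B) := measure_mono
        (add_subset_add (insert_subset ha hKA) (insert_subset hb hLB))

theorem sqrt_add_sqrt_sq_le {a b x y : ℝ} (ha : 0 < a) (hb : 0 < b) (hx : 0 ≤ x) (hy : 0 ≤ y) :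
    (√x + √y) ^ 2 ≤ (a + b) * (x / a + y / b) := by
  obtain ⟨p, hp, rfl⟩ : ∃ p, 0 ≤ p ∧ x = p ^ 2 := ⟨√x, sqrt_nonneg x, (sq_sqrt hx).symm⟩
  obtain ⟨q, hq, rfl⟩ : ∃ q, 0 ≤ q ∧ y = q ^ 2 := ⟨√y, sqrt_nonneg y, (sq_sqrt hy).symm⟩
  rw [sqrt_sq hp, sqrt_sq hq]
  have : (a + b) * (p ^ 2 / a + q ^ 2 / b) - (p + q) ^ 2 = (b * p - a * q) ^ 2 / (a * b) := by
    field_simp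
    ring
  have h2 : 0 ≤ (b * p - a * q) ^ 2 / (a * b) := by positivity
  linarith

theorem lintegral_measure_slice {A : Set (ℝ × ℝ)} (hA : MeasurableSet A)
    (hfin : ∀ x, volume (Prod.mk x ⁻¹' A) ≠ ∞) {a : ℝ} (ha : 0 < a) :
    volume A / ENNReal.ofReal a =
      ∫⁻ t in Ioi 0, volume {x | t < (volume (Prod.mk x ⁻¹' A)).toReal / a} := by
  have hm : Measurable fun x => volume (Prod.mk x ⁻¹' A) := measurable_measure_prodMk_left hA
  rw [← lintegral_eq_lintegral_meas_lt]
  · rw [Measure.volume_eq_prod, Measure.prod_apply hA, ENNReal.div_eq_inv_mul,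
      ← lintegral_const_mul _ hm]
    refine lintegral_congr fun x => ?_
    rw [ENNReal.ofReal_div_of_pos ha, ENNReal.ofReal_toReal (hfin x), ENNReal.div_eq_inv_mul]
  · exact Eventually.of_forall fun x => by positivity
  · exact (hm.ennreal_toReal.div_const a).aemeasurable

theorem exists_slice_sup {A : Set (ℝ × ℝ)} (hA : IsOpen A) (hb : Bornology.IsBounded A)
    (hA0 : A.Nonempty) : (∀ x, volume (Prod.mk x ⁻¹' A) ≠ ∞) ∧ ∃ a : ℝ, 0 < a ∧
      (∀ x, (volume (Prod.mk x ⁻¹' A)).toReal ≤ a) ∧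
      ∀ t < 1, ∃ x, t < (volume (Prod.mk x ⁻¹' A)).toReal / a := by
  obtain ⟨r, hr⟩ := hb.subset_closedBall 0
  have hsub : ∀ x, Prod.mk x ⁻¹' A ⊆ Icc (-r) r := by
    intro x y hy
    have := hr hy
    rw [mem_closedBall_zero_iff, Prod.norm_def] at this
    exact abs_le.1 ((le_max_right _ _).trans this)
  have hle : ∀ x, volume (Prod.mk x ⁻¹' A) ≤ ENNReal.ofReal (r - -r) := fun x =>
    (measure_mono (hsub x)).trans (by rw [Real.volume_Icc])
  have hfin : ∀ x, volume (Prod.mk x ⁻¹' A) ≠ ∞ := fun x =>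
    ((hle x).trans_lt ENNReal.ofReal_lt_top).ne
  have hbdd : BddAbove (range fun x => (volume (Prod.mk x ⁻¹' A)).toReal) := by
    refine ⟨(ENNReal.ofReal (r - -r)).toReal, ?_⟩
    rintro _ ⟨x, rfl⟩
    exact ENNReal.toReal_mono ENNReal.ofReal_ne_top (hle x)
  obtain ⟨⟨x₀, y₀⟩, h₀⟩ := hA0
  have hpos : 0 < (volume (Prod.mk x₀ ⁻¹' A)).toReal := by
    refine ENNReal.toReal_pos ?_ (hfin x₀)
    exact ((hA.preimage (by fun_prop)).measure_pos volume ⟨y₀, h₀⟩).ne'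
  have hsup : 0 < ⨆ x, (volume (Prod.mk x ⁻¹' A)).toReal := hpos.trans_le (le_ciSup hbdd x₀)
  refine ⟨hfin, _, hsup, le_ciSup hbdd, fun t ht => ?_⟩
  simp only [lt_div_iff₀ hsup]
  exact exists_lt_of_lt_ciSup ((mul_lt_iff_lt_one_left hsup).2 ht)

/-- The Brunn-Minkowski inequality for bounded open sets in the plane. -/
theorem sqrt_volume_add_sq_le {A B : Set (ℝ × ℝ)} (hA : IsOpen A) (hB : IsOpen B)
    (hAb : Bornology.IsBounded A) (hBb : Bornology.IsBounded B)
    (hA0 : A.Nonempty) (hB0 : B.Nonempty) :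
    (√(volume A).toReal + √(volume B).toReal) ^ 2 ≤ (volume (A + B)).toReal := by
  obtain ⟨hfA, a, ha, hale, hasup⟩ := exists_slice_sup hA hAb hA0
  obtain ⟨hfB, b, hb, hble, hbsup⟩ := exists_slice_sup hB hBb hB0
  have hCb : Bornology.IsBounded (A + B) := hAb.add hBb
  have hC : IsOpen (A + B) := hA.add_right
  obtain ⟨hfC, -⟩ := exists_slice_sup hC hCb (hA0.add hB0)
  have key : volume A / ENNReal.ofReal a + volume B / ENNReal.ofReal b ≤
      volume (A + B) / ENNReal.ofReal (a + b) := by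
    have hmA : Measurable fun x => (volume (Prod.mk x ⁻¹' A)).toReal / a :=
      (measurable_measure_prodMk_left hA.measurableSet).ennreal_toReal.div_const a
    have hmB : Measurable fun x => (volume (Prod.mk x ⁻¹' B)).toReal / b :=
      (measurable_measure_prodMk_left hB.measurableSet).ennreal_toReal.div_const b
    rw [lintegral_measure_slice hA.measurableSet hfA ha,
      lintegral_measure_slice hB.measurableSet hfB hb,
      lintegral_measure_slice hC.measurableSet hfC (add_pos ha hb), ← lintegral_add_left]
    · refine setLIntegral_mono' measurableSet_Ioi fun t ht => ?_
      rcases lt_or_ge t 1 with h1 | h1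
      · refine (volume_add_le_volume_add (measurableSet_lt measurable_const hmA)
          (measurableSet_lt measurable_const hmB) (hasup t h1) (hbsup t h1)).trans
          (measure_mono ?_)
        rintro _ ⟨x, hx, y, hy, rfl⟩
        simp only [mem_ofPred_eq] at hx hy ⊢
        rw [lt_div_iff₀ ha] at hx
        rw [lt_div_iff₀ hb] at hy
        rw [lt_div_iff₀ (add_pos ha hb)]
        have hneA : (Prod.mk x ⁻¹' A).Nonempty := by
          rw [nonempty_iff_ne_empty]
          intro h
          rw [h] at hx
          simp only [measure_empty, ENNReal.toReal_zero] at hx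
          exact absurd hx (not_lt.2 (mul_nonneg (le_of_lt ht) ha.le))
        have hneB : (Prod.mk y ⁻¹' B).Nonempty := by
          rw [nonempty_iff_ne_empty]
          intro h
          rw [h] at hy
          simp only [measure_empty, ENNReal.toReal_zero] at hy
          exact absurd hy (not_lt.2 (mul_nonneg (le_of_lt ht) hb.le))
        have hsl : volume (Prod.mk x ⁻¹' A) + volume (Prod.mk y ⁻¹' B) ≤
            volume (Prod.mk (x + y) ⁻¹' (A + B)) := by
          refine (volume_add_le_volume_add (hA.preimage (by fun_prop)).measurableSet
            (hB.preimage (by fun_prop)).measurableSet hneA hneB).trans (measure_mono ?_)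
          rintro _ ⟨p, hp, q, hq, rfl⟩
          exact ⟨(x, p), hp, (y, q), hq, rfl⟩
        have := ENNReal.toReal_mono (hfC _) hsl
        rw [ENNReal.toReal_add (hfA _) (hfB _)] at this
        linarith
      · have e1 : {x | t < (volume (Prod.mk x ⁻¹' A)).toReal / a} = ∅ := by
          ext x
          simpa using ((div_le_one ha).2 (hale x)).trans h1
        have e2 : {x | t < (volume (Prod.mk x ⁻¹' B)).toReal / b} = ∅ := by
          ext x
          simpa using ((div_le_one hb).2 (hble x)).trans h1
        simp [e1, e2]
    · have : Antitone fun t => volume {x | t < (volume (Prod.mk x ⁻¹' A)).toReal / a} :=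
        fun s t hst => measure_mono fun x hx => lt_of_le_of_lt hst hx
      exact this.measurable
  have hA' := hAb.measure_lt_top (μ := volume)
  have hB' := hBb.measure_lt_top (μ := volume)
  have hC' := hCb.measure_lt_top (μ := volume)
  have key' := ENNReal.toReal_mono (ENNReal.div_lt_top hC'.ne (by simp; positivity)).ne key
  rw [ENNReal.toReal_add (ENNReal.div_lt_top hA'.ne (by simpa using ha)).ne
    (ENNReal.div_lt_top hB'.ne (by simpa using hb)).ne] at key'
  simp only [ENNReal.toReal_div, ENNReal.toReal_ofReal ha.le, ENNReal.toReal_ofReal hb.le,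
    ENNReal.toReal_ofReal (add_pos ha hb).le] at key'
  rw [le_div_iff₀ (add_pos ha hb)] at key'
  refine (sqrt_add_sqrt_sq_le ha hb ENNReal.toReal_nonneg ENNReal.toReal_nonneg).trans ?_
  linarith

theorem volume_toReal_ball_E2 (h : ℝ) (hh : 0 ≤ h) (x : E2) :
    (volume (Metric.ball x h)).toReal = π * h ^ 2 := by
  rw [EuclideanSpace.volume_ball_fin_two]
  simp [ENNReal.toReal_mul, ENNReal.toReal_ofReal hh, ENNReal.toReal_ofReal pi_pos.le]
  ring

/-- The Brunn-Minkowski inequality for a bounded open set and a disk. -/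
theorem sqrt_volume_add_le_volume_add_ball {A : Set E2} (hA : IsOpen A)
    (hAb : Bornology.IsBounded A) (hA0 : A.Nonempty) {h : ℝ} (hh : 0 < h) :
    (√(volume A).toReal + √π * h) ^ 2 ≤ (volume (A + Metric.ball 0 h)).toReal := by
  let e : (ℝ × ℝ) ≃ᵐ E2 :=
    (MeasurableEquiv.finTwoArrow (α := ℝ)).symm.trans (MeasurableEquiv.toLp 2 (Fin 2 → ℝ))
  have he : MeasurePreserving e volume volume :=
    ((volume_preserving_finTwoArrow ℝ).symm _).trans
      (PiLp.volume_preserving_toLp (Fin 2))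
  let φ : E2 ≃L[ℝ] (ℝ × ℝ) := (EuclideanSpace.equiv (Fin 2) ℝ).trans
    (ContinuousLinearEquiv.finTwoArrow ℝ ℝ)
  have hφ : ∀ x, φ (e x) = x := by
    rintro ⟨a, b⟩
    simp [φ, e]
  have hpre : ∀ S : Set E2, e ⁻¹' S = φ '' S := by
    intro S
    ext x
    constructor
    · intro hx
      exact ⟨e x, hx, hφ x⟩
    · rintro ⟨y, hy, rfl⟩
      have : e (φ y) = y := φ.injective (hφ _)
      simpa [this] using hy
  have hv : ∀ S : Set E2, volume (φ '' S) = volume S := by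
    intro S
    rw [← hpre, he.measure_preimage_equiv]
  have hop : ∀ S : Set E2, IsOpen S → IsOpen (φ '' S) := fun S hS =>
    φ.toHomeomorph.isOpenMap S hS
  have hbd : ∀ S : Set E2, Bornology.IsBounded S → Bornology.IsBounded (φ '' S) := fun S hS =>
    φ.lipschitz.isBounded_image hS
  have := sqrt_volume_add_sq_le (hop A hA) (hop _ (Metric.isOpen_ball (x := (0 : E2)) (ε := h)))
    (hbd A hAb) (hbd _ Metric.isBounded_ball) (hA0.image _)
    ((Metric.nonempty_ball.2 hh).image _)
  rw [← image_add, hv, hv, hv, volume_toReal_ball_E2 h hh.le, sqrt_mul pi_pos.le,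
    sqrt_sq hh.le] at this
  exact this

end BrunnMinkowski

section LevelSets

open scoped Pointwise Topology

theorem exists_abs_add_le {u : E2 → ℝ} (hu : ContDiff ℝ (⊤ : ℕ∞) u) (hc : HasCompactSupport u) :
    ∃ M : ℝ, 0 ≤ M ∧ ∀ x y, |u (x + y)| ≤ |u x| + ‖fderiv ℝ u x‖ * ‖y‖ + M * ‖y‖ ^ 2 := by
  have hd : ContDiff ℝ 1 (fderiv ℝ u) := (contDiff_infty.1 hu 2).fderiv_right
    (by norm_num)
  obtain ⟨C, hC⟩ := hd.lipschitzWith_of_hasCompactSupport (hc.fderiv ℝ) one_ne_zero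
  refine ⟨C, C.2, fun x y => ?_⟩
  have h1 : ‖u (x + y) - u x - fderiv ℝ u x (x + y - x)‖ ≤ (C * ‖y‖) * ‖x + y - x‖ := by
    refine (convex_closedBall x ‖y‖).norm_image_sub_le_of_norm_fderiv_le' (𝕜 := ℝ)
      (fun z _ => (hu.differentiable (by simp)).differentiableAt) (fun z hz => ?_)
      (by simp) (by simp)
    refine (hC.norm_sub_le z x).trans ?_
    rw [mem_closedBall_iff_norm] at hz
    gcongr
  rw [add_sub_cancel_left, Real.norm_eq_abs] at h1
  have h2 := (fderiv ℝ u x).le_opNorm y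
  rw [Real.norm_eq_abs] at h2
  have h3 : u (x + y) = (u (x + y) - u x - fderiv ℝ u x y) + u x + fderiv ℝ u x y := by ring
  rw [h3]
  refine (abs_add_three _ _ _).trans ?_
  nlinarith

/-- Isoperimetry for superlevel sets, in terms of an outer first-order expansion of `|u|`. -/
theorem volume_superlevel_add_le {u : E2 → ℝ} (hu : Continuous u) (hc : HasCompactSupport u)
    {M : ℝ} (hM0 : 0 ≤ M)
    (hM : ∀ x y, |u (x + y)| ≤ |u x| + ‖fderiv ℝ u x‖ * ‖y‖ + M * ‖y‖ ^ 2)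
    {s h κ : ℝ} (hh : 0 < h) (hs : M * h ^ 2 < s) (hκ : 0 < κ)
    (hκs : κ ≤ (volume {x | s < |u x|}).toReal) :
    volume {x | s < |u x|} + ENNReal.ofReal (2 * √(π * κ) * h) ≤
      volume {x | s < |u x| + ‖fderiv ℝ u x‖ * h + M * h ^ 2} := by
  have hs0 : 0 < s := lt_of_le_of_lt (by positivity) hs
  have hAo : IsOpen {x | s < |u x|} := isOpen_lt continuous_const hu.abs
  have hAt : {x | s < |u x|} ⊆ tsupport u := fun x hx => by
    refine subset_tsupport u fun h0 => ?_
    rw [mem_ofPred_eq, h0, abs_zero] at hx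
    linarith
  have hFt : {x | s < |u x| + ‖fderiv ℝ u x‖ * h + M * h ^ 2} ⊆ tsupport u := fun x hx => by
    by_contra hxt
    have h1 : u x = 0 := image_eq_zero_of_notMem_tsupport hxt
    have h2 : fderiv ℝ u x = 0 := by
      by_contra h3
      exact hxt (support_fderiv_subset ℝ h3)
    rw [mem_ofPred_eq, h1, h2] at hx
    simp at hx
    linarith
  have hfin : volume (tsupport u) < ∞ := IsCompact.measure_lt_top hc
  have hA0 : {x | s < |u x|}.Nonempty := by
    rw [nonempty_iff_ne_empty]
    intro h0
    rw [h0] at hκs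
    simp at hκs
    linarith
  have bm := sqrt_volume_add_le_volume_add_ball hAo (hc.isBounded.subset hAt) hA0 hh
  have hsub : {x | s < |u x|} + Metric.ball (0 : E2) h ⊆
      {x | s < |u x| + ‖fderiv ℝ u x‖ * h + M * h ^ 2} := by
    rintro _ ⟨x, hx, y, hy, rfl⟩
    have h1 := hM (x + y) (-y)
    rw [add_neg_cancel_right, norm_neg] at h1
    rw [mem_ball_zero_iff] at hy
    have h2 : ‖fderiv ℝ u (x + y)‖ * ‖y‖ ≤ ‖fderiv ℝ u (x + y)‖ * h := by gcongr
    have h3 : M * ‖y‖ ^ 2 ≤ M * h ^ 2 := by gcongr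
    simp only [mem_ofPred_eq] at hx ⊢
    linarith
  have hF := ((measure_mono hFt).trans_lt hfin).ne
  have hA := ((measure_mono hAt).trans_lt hfin).ne
  have hle := bm.trans (ENNReal.toReal_mono hF (measure_mono hsub))
  rw [← ENNReal.ofReal_toReal hA, ← ENNReal.ofReal_toReal hF,
    ← ENNReal.ofReal_add ENNReal.toReal_nonneg (by positivity)]
  apply ENNReal.ofReal_le_ofReal
  refine le_trans ?_ hle
  have h4 : √(π * κ) ≤ √π * √(volume {x | s < |u x|}).toReal := by
    rw [← sqrt_mul pi_pos.le]
    gcongr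
  rw [add_sq, sq_sqrt ENNReal.toReal_nonneg]
  have h5 : 0 ≤ (√π * h) ^ 2 := sq_nonneg _
  nlinarith

theorem lintegral_clip {f : E2 → ℝ} (hf : Measurable f) (a b : ℝ) :
    ∫⁻ x, ENNReal.ofReal (max 0 (min (f x) b - a)) =
      ∫⁻ t in Ioi 0, volume {x | a + t < f x ∧ a + t < b} := by
  rw [lintegral_eq_lintegral_meas_lt]
  · refine setLIntegral_congr_fun measurableSet_Ioi fun t ht => ?_
    congr 1
    ext x
    have ht0 : 0 < t := ht
    simp only [mem_ofPred_eq, lt_max_iff, lt_sub_iff_add_lt, lt_min_iff, add_comm t a]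
    constructor
    · rintro (h | h)
      · linarith
      · exact h
    · exact fun h => Or.inr h
  · exact Eventually.of_forall fun x => le_max_left _ _
  · exact (measurable_const.max ((hf.min measurable_const).sub_const a)).aemeasurable

/-- The isoperimetric inequality integrated over a range of levels. -/
theorem le_setIntegral_norm_fderiv {u : E2 → ℝ} (hu : ContDiff ℝ (⊤ : ℕ∞) u)
    (hc : HasCompactSupport u) {a b κ : ℝ} (ha : 0 ≤ a) (hab : a < b) (hκ : 0 < κ)
    (hκs : ∀ s, a < s → s < b → κ ≤ (volume {x | s < |u x|}).toReal) :
    2 * √(π * κ) * (b - a) ≤ ∫ x in {x | a < |u x| ∧ |u x| < b}, ‖fderiv ℝ u x‖ := by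
  obtain ⟨M, hM0, hM⟩ := exists_abs_add_le hu hc
  have hdc : Continuous fun x => ‖fderiv ℝ u x‖ := (hu.continuous_fderiv (by simp)).norm
  obtain ⟨N, hN⟩ : ∃ N, ∀ x, ‖fderiv ℝ u x‖ ≤ N := by
    obtain ⟨N, hN⟩ := (hu.continuous_fderiv (by simp)).bounded_above_of_compact_support
      (hc.fderiv ℝ)
    exact ⟨N, hN⟩
  have hN0 : 0 ≤ N := (norm_nonneg _).trans (hN 0)
  set S := {x | a < |u x| ∧ |u x| < b} with hS
  have huc := hu.continuous
  have hSm : MeasurableSet S := ((isOpen_lt continuous_const huc.abs).inter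
    (isOpen_lt huc.abs continuous_const)).measurableSet
  have hSt : S ⊆ tsupport u := fun x hx => by
    refine subset_tsupport u fun h0 => ?_
    have := hx.1
    rw [h0, abs_zero] at this
    linarith
  have hfin : volume (tsupport u) < ∞ := IsCompact.measure_lt_top hc
  have hSf : volume S < ∞ := (measure_mono hSt).trans_lt hfin
  have hgi : IntegrableOn (fun x => ‖fderiv ℝ u x‖) S :=
    (hdc.integrable_of_hasCompactSupport (hc.fderiv ℝ).norm).integrableOn
  have main : ∀ a', a < a' → a' < b → ∀ h, 0 < h → N * h + M * h ^ 2 ≤ a' - a →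
      2 * √(π * κ) * (b - a') ≤
        (∫ x in S, ‖fderiv ℝ u x‖) + M * h * (volume S).toReal := by
    intro a' haa' ha'b h hh hsm
    let f : E2 → ℝ := fun x => |u x| + ‖fderiv ℝ u x‖ * h + M * h ^ 2
    have hfc : Continuous f := by fun_prop
    have h1 : (∫⁻ x, ENNReal.ofReal (max 0 (min |u x| b - a'))) +
        ENNReal.ofReal (2 * √(π * κ) * h) * ENNReal.ofReal (b - a') ≤
        ∫⁻ x, ENNReal.ofReal (max 0 (min (f x) b - a')) := by
      rw [lintegral_clip huc.abs.measurable, lintegral_clip hfc.measurable]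
      have e1 : ENNReal.ofReal (2 * √(π * κ) * h) * ENNReal.ofReal (b - a') =
          ∫⁻ t in Ioi 0, (Iio (b - a')).indicator
            (fun _ => ENNReal.ofReal (2 * √(π * κ) * h)) t := by
        rw [lintegral_indicator measurableSet_Iio, setLIntegral_const,
          Measure.restrict_apply measurableSet_Iio, inter_comm, Ioi_inter_Iio, Real.volume_Ioo,
          sub_zero]
      rw [e1, ← lintegral_add_right _ (measurable_const.indicator measurableSet_Iio)]
      refine setLIntegral_mono' measurableSet_Ioi fun t ht => ?_
      have ht0 : 0 < t := ht
      by_cases htb : a' + t < b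
      · rw [indicator_of_mem (by rw [mem_Iio]; linarith)]
        simp only [htb, and_true]
        refine volume_superlevel_add_le huc hc hM0 hM hh ?_ hκ (hκs _ (by linarith) htb)
        have : 0 ≤ N * h := by positivity
        linarith
      · rw [indicator_of_notMem (by rw [mem_Iio]; linarith)]
        simp [htb]
    have h2 : (∫⁻ x, ENNReal.ofReal (max 0 (min (f x) b - a'))) ≤
        (∫⁻ x, ENNReal.ofReal (max 0 (min |u x| b - a'))) +
          ∫⁻ x in S, ENNReal.ofReal (‖fderiv ℝ u x‖ * h + M * h ^ 2) := by
      rw [← lintegral_indicator hSm, ← lintegral_add_left]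
      · refine lintegral_mono fun x => ?_
        have hD : ‖fderiv ℝ u x‖ * h ≤ N * h := by gcongr; exact hN x
        have hD0 : 0 ≤ ‖fderiv ℝ u x‖ * h := by positivity
        have hM2 : 0 ≤ M * h ^ 2 := by positivity
        by_cases hx : x ∈ S
        · rw [indicator_of_mem hx, ← ENNReal.ofReal_add (le_max_left _ _) (by positivity)]
          apply ENNReal.ofReal_le_ofReal
          simp only [f]
          rcases max_cases 0 (min |u x| b - a') with h₁ | h₁ <;>
          rcases max_cases 0 (min (|u x| + ‖fderiv ℝ u x‖ * h + M * h ^ 2) b - a') with h₂ | h₂ <;>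
          rcases min_cases (|u x| + ‖fderiv ℝ u x‖ * h + M * h ^ 2) b with h₃ | h₃ <;>
          rcases min_cases (|u x|) b with h₄ | h₄ <;> linarith
        · rw [indicator_of_notMem hx, add_zero]
          apply ENNReal.ofReal_le_ofReal
          simp only [f]
          rcases le_or_gt (|u x|) a with h3 | h3
          · rw [max_eq_left]
            · exact le_max_left _ _
            · have := min_le_left (|u x| + ‖fderiv ℝ u x‖ * h + M * h ^ 2) b
              linarith
          · have h4 : b ≤ |u x| := by
              by_contra h5
              exact hx ⟨h3, not_le.1 h5⟩
            rw [min_eq_right h4]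
            gcongr
            exact min_le_right _ _
      · exact (measurable_const.max
          ((huc.abs.measurable.min measurable_const).sub_const a')).ennreal_ofReal
    have h3 : (∫⁻ x, ENNReal.ofReal (max 0 (min |u x| b - a'))) ≠ ∞ := by
      refine ne_top_of_le_ne_top (b := ∫⁻ x in tsupport u, ENNReal.ofReal (b - a')) ?_ ?_
      · rw [setLIntegral_const]
        exact ENNReal.mul_ne_top ENNReal.ofReal_ne_top hfin.ne
      · rw [← lintegral_indicator (isClosed_tsupport u).measurableSet]
        refine lintegral_mono fun x => ?_
        by_cases hx : x ∈ tsupport u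
        · rw [indicator_of_mem hx]
          apply ENNReal.ofReal_le_ofReal
          refine max_le (by linarith) ?_
          gcongr
          exact min_le_right _ _
        · rw [image_eq_zero_of_notMem_tsupport hx, abs_zero, min_eq_left (by linarith),
            max_eq_left (by linarith)]
          simp
    have h4 := (ENNReal.add_le_add_iff_left h3).1 (h1.trans h2)
    have hint2 : IntegrableOn (fun x => ‖fderiv ℝ u x‖ * h + M * h ^ 2) S :=
      (hgi.mul_const h).add (integrableOn_const hSf.ne)
    rw [← ENNReal.ofReal_mul (by positivity), ← ofReal_integral_eq_lintegral_ofReal hint2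
      (Eventually.of_forall fun x => by positivity)] at h4
    rw [ENNReal.ofReal_le_ofReal_iff (integral_nonneg fun x => by positivity),
      integral_add (hgi.mul_const h) (integrableOn_const hSf.ne), integral_mul_const,
      setIntegral_const, smul_eq_mul] at h4
    have h5 : h * (2 * √(π * κ) * (b - a')) ≤
        h * ((∫ x in S, ‖fderiv ℝ u x‖) + M * h * (volume S).toReal) := by
      rw [measureReal_def] at h4
      linarith
    exact le_of_mul_le_mul_left h5 hh
  have step : ∀ a', a < a' → a' < b →
      2 * √(π * κ) * (b - a') ≤ ∫ x in S, ‖fderiv ℝ u x‖ := by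
    intro a' h1 h2
    have hlim : Tendsto (fun h => (∫ x in S, ‖fderiv ℝ u x‖) + M * h * (volume S).toReal)
        (𝓝[>] 0) (𝓝 ((∫ x in S, ‖fderiv ℝ u x‖) + M * 0 * (volume S).toReal)) :=
      Tendsto.mono_left (Continuous.tendsto (by fun_prop) 0) nhdsWithin_le_nhds
    rw [mul_zero, zero_mul, add_zero] at hlim
    refine ge_of_tendsto hlim ?_
    have hlim2 : Tendsto (fun h => N * h + M * h ^ 2) (𝓝[>] 0) (𝓝 (N * 0 + M * 0 ^ 2)) :=
      Tendsto.mono_left (Continuous.tendsto (by fun_prop) 0) nhdsWithin_le_nhds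
    have hpos : N * 0 + M * 0 ^ 2 < a' - a := by simpa using h1
    filter_upwards [hlim2.eventually_lt_const hpos, self_mem_nhdsWithin] with h hh1 hh2
    exact main a' h1 h2 h hh2 hh1.le
  have hlim : Tendsto (fun a' => 2 * √(π * κ) * (b - a')) (𝓝[>] a)
      (𝓝 (2 * √(π * κ) * (b - a))) :=
    Tendsto.mono_left (Continuous.tendsto (by fun_prop) a) nhdsWithin_le_nhds
  refine le_of_tendsto hlim ?_
  filter_upwards [Ioo_mem_nhdsGT hab] with a' ha'
  exact step a' ha'.1 ha'.2

theorem sq_le_mul_of_forall_quadratic_nonneg {V I J : ℝ}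
    (h : ∀ c : ℝ, 0 ≤ J - 2 * c * I + c ^ 2 * V) : I ^ 2 ≤ V * J := by
  have hd := discrim_le_zero (a := V) (b := -2 * I) (c := J) (fun c => by linarith [h c])
  rw [discrim] at hd
  linarith

theorem sq_setIntegral_le {α : Type*} [MeasurableSpace α] {μ : Measure α} {S : Set α} {g : α → ℝ}
    (h1 : IntegrableOn g S μ) (h2 : IntegrableOn (fun x => g x ^ 2) S μ) (hS : μ S ≠ ∞) :
    (∫ x in S, g x ∂μ) ^ 2 ≤ (μ S).toReal * ∫ x in S, g x ^ 2 ∂μ := by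
  refine sq_le_mul_of_forall_quadratic_nonneg fun c => ?_
  have : 0 ≤ ∫ x in S, (g x - c) ^ 2 ∂μ := integral_nonneg fun x => sq_nonneg _
  have e : ∀ x, (g x - c) ^ 2 = g x ^ 2 - 2 * c * g x + c ^ 2 := fun x => by ring
  simp_rw [e] at this
  have h3 : IntegrableOn (fun x => g x ^ 2 - 2 * c * g x) S μ := h2.sub (h1.const_mul _)
  rw [integral_add h3 (integrableOn_const hS), integral_sub h2 (h1.const_mul _), integral_const_mul, setIntegral_const, smul_eq_mul,
    measureReal_def] at this
  linarith

theorem integrable_norm_fderiv_sq {u : E2 → ℝ} (hu : ContDiff ℝ (⊤ : ℕ∞) u)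
    (hc : HasCompactSupport u) : Integrable (fun x => ‖fderiv ℝ u x‖ ^ 2) := by
  refine Continuous.integrable_of_hasCompactSupport
    ((hu.continuous_fderiv (by simp)).norm.pow 2) ?_
  refine (hc.fderiv ℝ).mono fun x hx h => hx ?_
  simp [h]

/-- The condenser estimate between two levels of `|u|`. -/
theorem mul_sub_sq_le_setIntegral_sq {u : E2 → ℝ} (hu : ContDiff ℝ (⊤ : ℕ∞) u)
    (hc : HasCompactSupport u) {a b κ : ℝ} (ha : 0 ≤ a) (hab : a < b) (hκ : 0 < κ)
    (hκs : ∀ s, a < s → s < b → κ ≤ (volume {x | s < |u x|}).toReal) :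
    4 * π * κ * (b - a) ^ 2 ≤ (volume {x | a < |u x| ∧ |u x| < b}).toReal *
      ∫ x in {x | a < |u x| ∧ |u x| < b}, ‖fderiv ℝ u x‖ ^ 2 := by
  have hfin : volume {x | a < |u x| ∧ |u x| < b} ≠ ∞ := by
    have hfin : volume (tsupport u) < ∞ := IsCompact.measure_lt_top hc
    refine ((measure_mono fun x hx => ?_).trans_lt hfin).ne
    refine subset_tsupport u fun h0 => ?_
    have := hx.1
    rw [h0, abs_zero] at this
    linarith
  refine le_trans ?_ (sq_setIntegral_le
    ((hu.continuous_fderiv (by simp)).norm.integrable_of_hasCompactSupport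
      (hc.fderiv ℝ).norm).integrableOn (integrable_norm_fderiv_sq hu hc).integrableOn hfin)
  have h1 := le_setIntegral_norm_fderiv hu hc ha hab hκ hκs
  have h2 : 4 * π * κ * (b - a) ^ 2 = (2 * √(π * κ) * (b - a)) ^ 2 := by
    rw [mul_pow, mul_pow, sq_sqrt (by positivity)]
    ring
  rw [h2]
  have : 0 ≤ b - a := by linarith
  gcongr

end LevelSets

section ExponentialProfile

open scoped Pointwise Topology

/-- The exponential distribution with density `exp (-t)` on `(0, ∞)`. -/
def expM : Measure ℝ :=
  (volume.restrict (Ioi 0)).withDensity fun t => ENNReal.ofReal (exp (-t))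

theorem expM_Ioi {s : ℝ} (hs : 0 ≤ s) : expM (Ioi s) = ENNReal.ofReal (exp (-s)) := by
  rw [expM, withDensity_apply _ measurableSet_Ioi, Measure.restrict_restrict measurableSet_Ioi,
    Ioi_inter_Ioi, max_eq_left hs, ← ofReal_integral_eq_lintegral_ofReal
      (integrableOn_exp_neg_Ioi s) (Eventually.of_forall fun x => (exp_pos _).le),
    integral_exp_neg_Ioi]

theorem expM_Iic_zero : expM (Iic 0) = 0 := by
  rw [expM, withDensity_apply _ measurableSet_Iic, Measure.restrict_restrict measurableSet_Iic,
    Iic_inter_Ioi, Ioc_self]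
  simp

instance : IsProbabilityMeasure expM := by
  refine ⟨?_⟩
  rw [← Iic_union_Ioi (a := (0 : ℝ)), measure_union (by
    rw [Set.disjoint_left]; intro x hx hx'; exact not_lt.2 (mem_Iic.1 hx) (mem_Ioi.1 hx')) measurableSet_Ioi,
    expM_Iic_zero, expM_Ioi le_rfl]
  simp

theorem lintegral_expM (f : ℝ → ℝ≥0∞) :
    ∫⁻ t, f t ∂expM = ∫⁻ t in Ioi 0, ENNReal.ofReal (exp (-t)) * f t := by
  rw [expM, lintegral_withDensity_eq_lintegral_mul_non_measurable]
  · rfl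
  · fun_prop
  · exact Eventually.of_forall fun t => ENNReal.ofReal_lt_top

theorem measure_ext_of_Ioi {μ ν : Measure ℝ} [IsFiniteMeasure μ] [IsFiniteMeasure ν]
    (huniv : μ univ = ν univ) (hμ : μ (Iio 0) = 0) (hν : ν (Iio 0) = 0)
    (h : ∀ s, 0 ≤ s → μ (Ioi s) = ν (Ioi s)) : μ = ν := by
  refine Measure.ext_of_Iic μ ν fun s => ?_
  rcases lt_or_ge s 0 with hs | hs
  · rw [measure_mono_null (Iic_subset_Iio.2 hs) hμ, measure_mono_null (Iic_subset_Iio.2 hs) hν]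
  · rw [← compl_Ioi, measure_compl measurableSet_Ioi (measure_ne_top _ _),
      measure_compl measurableSet_Ioi (measure_ne_top _ _), huniv, h s hs]

/-- The distribution function of `|u|`. -/
def distribution (u : E2 → ℝ) (s : ℝ) : ℝ := (volume {x | s < |u x|}).toReal

/-- The decreasing rearrangement of `|u|` in logarithmic coordinates: its value at `t` is the level
whose superlevel set has area `A * exp (-t)`. -/
def logRearrangement (u : E2 → ℝ) (A t : ℝ) : ℝ :=
  sInf {s : ℝ | 0 ≤ s ∧ distribution u s ≤ A * exp (-t)}

section Rearrangement

variable {u : E2 → ℝ} {A : ℝ}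

theorem volume_superlevel_ne_top (hc : HasCompactSupport u) {s : ℝ} (hs : 0 ≤ s) :
    volume {x | s < |u x|} ≠ ∞ := by
  have hfin : volume (tsupport u) < ∞ := IsCompact.measure_lt_top hc
  refine ((measure_mono fun x hx => ?_).trans_lt hfin).ne
  refine subset_tsupport u fun h0 => ?_
  rw [mem_ofPred_eq, h0, abs_zero] at hx
  linarith

theorem distribution_anti (hc : HasCompactSupport u) {s t : ℝ} (hs : 0 ≤ s) (hst : s ≤ t) :
    distribution u t ≤ distribution u s :=
  ENNReal.toReal_mono (volume_superlevel_ne_top hc hs) (measure_mono fun _ hx =>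
    lt_of_le_of_lt hst hx)

theorem distribution_nonneg (s : ℝ) : 0 ≤ distribution u s := ENNReal.toReal_nonneg

theorem exists_distribution_eq_zero (hu : Continuous u) (hc : HasCompactSupport u) :
    ∃ s, 0 ≤ s ∧ distribution u s = 0 := by
  obtain ⟨C, hC⟩ := hu.bounded_above_of_compact_support hc
  refine ⟨C, (norm_nonneg _).trans (hC 0), ?_⟩
  have : {x | C < |u x|} = ∅ := by
    ext x
    simpa using hC x
  simp [distribution, this]

theorem logRearrangement_bddBelow (t : ℝ) :
    BddBelow {s : ℝ | 0 ≤ s ∧ distribution u s ≤ A * exp (-t)} := ⟨0, fun _ h => h.1⟩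

theorem logRearrangement_nonneg (t : ℝ) : 0 ≤ logRearrangement u A t :=
  Real.sInf_nonneg fun _ h => h.1

theorem logRearrangement_le_iff (hu : Continuous u) (hc : HasCompactSupport u) (hA : 0 < A)
    {s t : ℝ} (hs : 0 ≤ s) :
    logRearrangement u A t ≤ s ↔ distribution u s ≤ A * exp (-t) := by
  constructor
  · intro h
    have hgt : ∀ r, s < r → distribution u r ≤ A * exp (-t) := by
      intro r hr
      obtain ⟨s₀, hs₀, h₀⟩ := exists_distribution_eq_zero hu hc
      obtain ⟨q, ⟨hq0, hq⟩, hqr⟩ := exists_lt_of_csInf_lt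
        (s := {s : ℝ | 0 ≤ s ∧ distribution u s ≤ A * exp (-t)})
        ⟨s₀, hs₀, by rw [h₀]; positivity⟩ (lt_of_le_of_lt h hr)
      exact (distribution_anti hc hq0 hqr.le).trans hq
    have hun : {x | s < |u x|} = ⋃ n : ℕ, {x | s + 1 / (n + 1 : ℝ) < |u x|} := by
      ext x
      simp only [mem_ofPred_eq, mem_iUnion]
      constructor
      · intro hx
        obtain ⟨n, hn⟩ := exists_nat_one_div_lt (sub_pos.2 hx)
        exact ⟨n, by linarith⟩
      · rintro ⟨n, hn⟩
        have : 0 < 1 / (n + 1 : ℝ) := by positivity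
        linarith
    rw [distribution, hun]
    refine ENNReal.toReal_le_of_le_ofReal (by positivity) ?_
    rw [Monotone.measure_iUnion]
    · refine iSup_le fun n => ?_
      have h1 : 0 < 1 / (n + 1 : ℝ) := by positivity
      rw [← ENNReal.ofReal_toReal (volume_superlevel_ne_top hc (by linarith))]
      exact ENNReal.ofReal_le_ofReal (hgt _ (by linarith))
    · intro m n hmn x hx
      simp only [mem_ofPred_eq] at hx ⊢
      have : 1 / (n + 1 : ℝ) ≤ 1 / (m + 1 : ℝ) := by gcongr
      linarith
  · exact fun h => csInf_le (logRearrangement_bddBelow t) ⟨hs, h⟩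

theorem lt_logRearrangement_iff (hu : Continuous u) (hc : HasCompactSupport u) (hA : 0 < A)
    {s t : ℝ} (hs : 0 ≤ s) :
    s < logRearrangement u A t ↔ A * exp (-t) < distribution u s := by
  rw [← not_le, logRearrangement_le_iff hu hc hA hs, not_le]

theorem logRearrangement_mono (hu : Continuous u) (hc : HasCompactSupport u) (hA : 0 < A) :
    Monotone (logRearrangement u A) := by
  intro a b hab
  rw [logRearrangement_le_iff hu hc hA (logRearrangement_nonneg b)]
  refine ((logRearrangement_le_iff hu hc hA (logRearrangement_nonneg b)).1 le_rfl).trans ?_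
  gcongr

theorem distribution_le {Ω : Set E2} (hΩ : volume Ω ≠ ∞) (hsub : tsupport u ⊆ Ω) {s : ℝ}
    (hs : 0 ≤ s) : distribution u s ≤ (volume Ω).toReal := by
  refine ENNReal.toReal_mono hΩ (measure_mono fun x hx => hsub ?_)
  refine subset_tsupport u fun h0 => ?_
  rw [mem_ofPred_eq, h0, abs_zero] at hx
  linarith

theorem logRearrangement_zero (hu : Continuous u) (hc : HasCompactSupport u) {Ω : Set E2}
    (hΩ : volume Ω ≠ ∞) (hA : 0 < (volume Ω).toReal) (hsub : tsupport u ⊆ Ω) :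
    logRearrangement u (volume Ω).toReal 0 = 0 := by
  refine le_antisymm ?_ (logRearrangement_nonneg _)
  rw [logRearrangement_le_iff hu hc hA le_rfl]
  simpa using distribution_le hΩ hsub le_rfl

/-- Equimeasurability of `|u|` and its rearrangement. -/
theorem map_logRearrangement (hu : Continuous u) (hc : HasCompactSupport u) {Ω : Set E2}
    (hΩ : volume Ω ≠ ∞) (hA : 0 < (volume Ω).toReal) (hsub : tsupport u ⊆ Ω) :
    (volume Ω • expM).map (logRearrangement u (volume Ω).toReal) =
      (volume.restrict Ω).map fun x => |u x| := by
  have hw := (logRearrangement_mono hu hc hA).measurable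
  have hv := hu.abs.measurable
  have : IsFiniteMeasure (volume.restrict Ω) := ⟨by simpa using hΩ.lt_top⟩
  have : IsFiniteMeasure (volume Ω • expM) := ⟨by simpa using hΩ.lt_top⟩
  refine measure_ext_of_Ioi ?_ ?_ ?_ fun s hs => ?_
  · rw [Measure.map_apply hw .univ, Measure.map_apply hv .univ]
    simp
  · rw [Measure.map_apply hw measurableSet_Iio]
    have : logRearrangement u (volume Ω).toReal ⁻¹' Iio 0 = ∅ := by
      ext t
      simpa using logRearrangement_nonneg t
    simp [this]
  · rw [Measure.map_apply hv measurableSet_Iio]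
    have : (fun x => |u x|) ⁻¹' Iio 0 = ∅ := by
      ext t
      simp
    simp [this]
  · rw [Measure.map_apply hw measurableSet_Ioi, Measure.map_apply hv measurableSet_Ioi,
      Measure.restrict_apply (hv measurableSet_Ioi)]
    have e1 : (fun x => |u x|) ⁻¹' Ioi s ∩ Ω = {x | s < |u x|} := by
      refine inter_eq_left.2 fun x hx => hsub (subset_tsupport u fun h0 => ?_)
      rw [mem_preimage, h0, abs_zero, mem_Ioi] at hx
      linarith
    rw [e1, Measure.smul_apply, smul_eq_mul, ← ENNReal.ofReal_toReal hΩ]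
    rw [← ENNReal.ofReal_toReal (volume_superlevel_ne_top hc hs)]
    change _ = ENNReal.ofReal (distribution u s)
    rcases (distribution_nonneg (u := u) s).eq_or_lt with h0 | h0
    · have : logRearrangement u (volume Ω).toReal ⁻¹' Ioi s = ∅ := by
        ext t
        simp only [mem_preimage, mem_Ioi, lt_logRearrangement_iff hu hc hA hs, ← h0,
          mem_empty_iff_false, iff_false, not_lt]
        positivity
      rw [ENNReal.toReal_ofReal ENNReal.toReal_nonneg, this, ← h0]
      simp
    · have : logRearrangement u (volume Ω).toReal ⁻¹' Ioi s =
          Ioi (log ((volume Ω).toReal / distribution u s)) := by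
        ext t
        rw [mem_preimage, mem_Ioi, mem_Ioi, lt_logRearrangement_iff hu hc hA hs,
          log_lt_iff_lt_exp (by positivity), div_lt_iff₀ h0, exp_neg, ← div_eq_mul_inv,
          div_lt_iff₀ (exp_pos t), mul_comm]
      rw [ENNReal.toReal_ofReal ENNReal.toReal_nonneg, this, expM_Ioi,
        ← ENNReal.ofReal_mul hA.le, exp_neg, exp_log (by positivity)]
      · congr 1
        field_simp
      · exact log_nonneg ((one_le_div h0).2 (distribution_le hΩ hsub hs))

/-- The Dirichlet energy of `u` below the level `logRearrangement u A t`. -/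
def energyBelow (u : E2 → ℝ) (A t : ℝ) : ℝ :=
  ∫ x in {x | |u x| < logRearrangement u A t}, ‖fderiv ℝ u x‖ ^ 2

theorem energyBelow_nonneg (t : ℝ) : 0 ≤ energyBelow u A t :=
  integral_nonneg fun _ => sq_nonneg _

theorem energyBelow_le (hu : ContDiff ℝ (⊤ : ℕ∞) u) (hc : HasCompactSupport u) (t : ℝ) :
    energyBelow u A t ≤ ∫ x, ‖fderiv ℝ u x‖ ^ 2 :=
  setIntegral_le_integral (integrable_norm_fderiv_sq hu hc)
    (Eventually.of_forall fun _ => sq_nonneg _)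

theorem energyBelow_mono (hu : ContDiff ℝ (⊤ : ℕ∞) u) (hc : HasCompactSupport u) (hA : 0 < A) :
    Monotone (energyBelow u A) := by
  intro a b hab
  refine setIntegral_mono_set (integrable_norm_fderiv_sq hu hc).integrableOn
    (Eventually.of_forall fun _ => sq_nonneg _) (Eventually.of_forall fun x hx => ?_)
  exact lt_of_lt_of_le hx (logRearrangement_mono hu.continuous hc hA hab)

theorem logRearrangement_increment (hu : ContDiff ℝ (⊤ : ℕ∞) u) (hc : HasCompactSupport u)
    (hA : 0 < A) {a b : ℝ} (hab : a ≤ b) :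
    4 * π * (logRearrangement u A b - logRearrangement u A a) ^ 2 ≤
      (exp (b - a) - 1) * (energyBelow u A b - energyBelow u A a) := by
  have huc := hu.continuous
  set w := logRearrangement u A with hw
  have hwm : w a ≤ w b := logRearrangement_mono huc hc hA hab
  have he0 : 0 ≤ exp (b - a) - 1 := by
    have := one_le_exp (sub_nonneg.2 hab)
    linarith
  rcases hwm.eq_or_lt with heq | hlt
  · rw [heq]
    have := energyBelow_mono hu hc hA hab
    simp only [sub_self]
    nlinarith [mul_nonneg he0 (sub_nonneg.2 this)]
  have hgi := integrable_norm_fderiv_sq hu hc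
  have hE : ∀ s, s < w b → ∫ x in {x | w a < |u x| ∧ |u x| < s}, ‖fderiv ℝ u x‖ ^ 2 ≤
      energyBelow u A b - energyBelow u A a := by
    intro s hs
    have hms : MeasurableSet {x | w a < |u x| ∧ |u x| < s} :=
      ((isOpen_lt continuous_const huc.abs).inter
        (isOpen_lt huc.abs continuous_const)).measurableSet
    rw [le_sub_iff_add_le, energyBelow, energyBelow, ← setIntegral_union ?_
      (isOpen_lt huc.abs continuous_const).measurableSet hgi.integrableOn hgi.integrableOn]
    · refine setIntegral_mono_set hgi.integrableOn (Eventually.of_forall fun _ => sq_nonneg _)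
        (Eventually.of_forall ?_)
      rintro x (hx | hx)
      · exact hx.2.trans hs
      · exact lt_of_lt_of_le hx hwm
    · rw [Set.disjoint_left]
      intro x hx hx'
      exact lt_asymm hx.1 hx'
  have hV : ∀ s, w a < s → s < w b → (volume {x | w a < |u x| ∧ |u x| < s}).toReal ≤
      A * exp (-a) - A * exp (-b) := by
    intro s has hs
    have hw0 : 0 ≤ w a := logRearrangement_nonneg a
    have h1 : distribution u (w a) ≤ A * exp (-a) :=
      (logRearrangement_le_iff huc hc hA hw0).1 le_rfl
    have h2 : A * exp (-b) < distribution u s :=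
      (lt_logRearrangement_iff huc hc hA (hw0.trans has.le)).1 hs
    have h3 : (volume {x | w a < |u x| ∧ |u x| < s}).toReal + distribution u s ≤
        distribution u (w a) := by
      rw [distribution, distribution, ← ENNReal.toReal_add, ← measure_union]
      · refine ENNReal.toReal_mono (volume_superlevel_ne_top hc hw0) (measure_mono ?_)
        rintro x (hx | hx)
        · exact hx.1
        · exact has.trans hx
      · rw [Set.disjoint_left]
        intro x hx hx'
        exact lt_asymm hx.2 hx'
      · exact (isOpen_lt continuous_const huc.abs).measurableSet
      · exact ne_top_of_le_ne_top (volume_superlevel_ne_top hc hw0)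
          (measure_mono fun x hx => hx.1)
      · exact volume_superlevel_ne_top hc (hw0.trans has.le)
    linarith
  have step : ∀ s, w a < s → s < w b → 4 * π * (A * exp (-b)) * (s - w a) ^ 2 ≤
      (A * exp (-a) - A * exp (-b)) * (energyBelow u A b - energyBelow u A a) := by
    intro s has hs
    refine (mul_sub_sq_le_setIntegral_sq hu hc (logRearrangement_nonneg a) has
      (by positivity : 0 < A * exp (-b)) fun r har hrs => ?_).trans ?_
    · exact ((lt_logRearrangement_iff huc hc hA ((logRearrangement_nonneg a).trans har.le)).1
        (hrs.trans hs)).le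
    · exact mul_le_mul (hV s has hs) (hE s hs) (integral_nonneg fun _ => sq_nonneg _)
        (ENNReal.toReal_nonneg.trans (hV s has hs))
  have hlim : 4 * π * (A * exp (-b)) * (w b - w a) ^ 2 ≤
      (A * exp (-a) - A * exp (-b)) * (energyBelow u A b - energyBelow u A a) := by
    have ht : Tendsto (fun s => 4 * π * (A * exp (-b)) * (s - w a) ^ 2) (𝓝[<] (w b))
        (𝓝 (4 * π * (A * exp (-b)) * (w b - w a) ^ 2)) :=
      Tendsto.mono_left (Continuous.tendsto (by fun_prop) _) nhdsWithin_le_nhds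
    refine le_of_tendsto ht ?_
    filter_upwards [Ioo_mem_nhdsLT hlt] with s hs
    exact step s hs.1 hs.2
  have hpos : 0 < A * exp (-b) := by positivity
  refine le_of_mul_le_mul_left ?_ hpos
  have e : A * exp (-a) - A * exp (-b) = A * exp (-b) * (exp (b - a) - 1) := by
    rw [mul_sub, mul_assoc, ← exp_add]
    ring_nf
  rw [e] at hlim
  linarith

end Rearrangement

end ExponentialProfile

section Increments

open scoped Pointwise Topology

/-- Increments controlled at small scales by `exp (b - a) - 1` are controlled at all scales by
`b - a`. -/
theorem sq_sub_le_of_exp {w F : ℝ → ℝ}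
    (hinc : ∀ a b, a ≤ b → (w b - w a) ^ 2 ≤ (exp (b - a) - 1) * (F b - F a)) {a b : ℝ}
    (hab : a ≤ b) : (w b - w a) ^ 2 ≤ (b - a) * (F b - F a) := by
  have key : ∀ n : ℕ, (w b - w a) ^ 2 ≤ (b - a) * exp ((b - a) / (n + 1 : ℝ)) * (F b - F a) := by
    intro n
    have hn : (0 : ℝ) < n + 1 := by positivity
    set d := (b - a) / (n + 1 : ℝ) with hd
    have hd0 : 0 ≤ d := div_nonneg (by linarith) hn.le
    let x : ℕ → ℝ := fun i => a + i * d
    have hx0 : x 0 = a := by simp [x]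
    have hxn : x (n + 1) = b := by simp only [x, hd]; push_cast; field_simp; ring
    have hstep : ∀ i, x (i + 1) - x i = d := by intro i; simp only [x]; push_cast; ring
    have h1 : w b - w a = ∑ i ∈ Finset.range (n + 1), (w (x (i + 1)) - w (x i)) := by
      rw [Finset.sum_range_sub (fun i => w (x i)), hx0, hxn]
    have h2 : F b - F a = ∑ i ∈ Finset.range (n + 1), (F (x (i + 1)) - F (x i)) := by
      rw [Finset.sum_range_sub (fun i => F (x i)), hx0, hxn]
    have hFab : 0 ≤ F b - F a ∨ w b - w a = 0 := by
      rcases hab.eq_or_lt with rfl | h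
      · right; ring
      · left
        have := hinc a b hab
        have h3 : 0 < exp (b - a) - 1 := by have := add_one_lt_exp (x := b - a) (by linarith); linarith
        by_contra h4
        push Not at h4
        nlinarith [sq_nonneg (w b - w a)]
    rcases hFab with hFab | h0
    · have h3 : exp d - 1 ≤ d * exp d := by
        have := add_one_le_exp (-d)
        have h4 : exp (-d) * exp d = 1 := by rw [← exp_add]; simp
        nlinarith [exp_pos d]
      calc (w b - w a) ^ 2 ≤ (n + 1 : ℝ) * ∑ i ∈ Finset.range (n + 1), (w (x (i + 1)) - w (x i)) ^ 2 := by
            rw [h1]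
            have := sq_sum_le_card_mul_sum_sq (s := Finset.range (n + 1))
              (f := fun i => w (x (i + 1)) - w (x i))
            simpa using this
        _ ≤ (n + 1 : ℝ) * ∑ i ∈ Finset.range (n + 1), (exp d - 1) * (F (x (i + 1)) - F (x i)) := by
            gcongr with i
            have := hinc (x i) (x (i + 1)) (by linarith [hstep i])
            rwa [hstep i] at this
        _ = (n + 1 : ℝ) * (exp d - 1) * (F b - F a) := by rw [← Finset.mul_sum, ← h2]; ring
        _ ≤ (n + 1 : ℝ) * (d * exp d) * (F b - F a) := by gcongr
        _ = (b - a) * exp d * (F b - F a) := by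
            have : (n + 1 : ℝ) * d = b - a := by rw [hd]; field_simp
            rw [← mul_assoc, this]
    · have := hinc a b hab
      rcases hab.eq_or_lt with rfl | h
      · simp
      · have h3 : 0 < exp (b - a) - 1 := by have := add_one_lt_exp (x := b - a) (by linarith); linarith
        have h5 : 0 ≤ F b - F a := by
          by_contra h4
          push Not at h4
          nlinarith [sq_nonneg (w b - w a)]
        rw [h0]
        have : 0 ≤ (b - a) := by linarith
        simp only [ne_eq, OfNat.ofNat_ne_zero, not_false_eq_true, zero_pow]
        positivity
  have hlim : Tendsto (fun n : ℕ => (b - a) * exp ((b - a) / (n + 1 : ℝ)) * (F b - F a)) atTop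
      (𝓝 ((b - a) * exp 0 * (F b - F a))) := by
    have h1 : Tendsto (fun n : ℕ => (b - a) / (n + 1 : ℝ)) atTop (𝓝 0) := by
      have := tendsto_one_div_add_atTop_nhds_zero_nat (𝕜 := ℝ)
      simpa [div_eq_mul_inv] using this.const_mul (b - a)
    exact ((((continuous_exp.tendsto 0).comp h1).const_mul _).mul_const _)
  have := ge_of_tendsto' hlim key
  simpa using this

section Profile

variable {w F : ℝ → ℝ}

theorem continuous_of_sq_sub_le {E : ℝ} (hF0 : ∀ t, 0 ≤ F t) (hE : ∀ t, F t ≤ E)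
    (hinc : ∀ a b, a ≤ b → (w b - w a) ^ 2 ≤ (b - a) * (F b - F a)) : Continuous w := by
  have hE0 : 0 ≤ E := (hF0 0).trans (hE 0)
  have key : ∀ a b, |w b - w a| ≤ √(|b - a| * E) := by
    intro a b
    apply abs_le_sqrt
    rcases le_total a b with h | h
    · rw [abs_of_nonneg (by linarith)]
      exact (hinc a b h).trans (mul_le_mul_of_nonneg_left (by linarith [hF0 a, hE b]) (by linarith))
    · rw [abs_of_nonpos (by linarith)]
      have := (hinc b a h).trans (mul_le_mul_of_nonneg_left
        (show F a - F b ≤ E by linarith [hF0 b, hE a]) (by linarith))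
      nlinarith
  rw [continuous_iff_continuousAt]
  intro a
  rw [ContinuousAt, tendsto_iff_dist_tendsto_zero]
  refine squeeze_zero (fun _ => dist_nonneg) (fun b => key a b) ?_
  have : Continuous fun b : ℝ => √(|b - a| * E) := by fun_prop
  simpa using this.tendsto a

/-- Backward difference quotient. -/
def diffQuot (w : ℝ → ℝ) (h s : ℝ) : ℝ := (w s - w (s - h)) / h

theorem intervalIntegrable_diffQuot (hw : Monotone w) (h a b : ℝ) :
    IntervalIntegrable (diffQuot w h) volume a b := by
  unfold diffQuot
  have h2 : Monotone fun s => w (s - h) := fun x y hxy => hw (by linarith)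
  exact (hw.intervalIntegrable.sub h2.intervalIntegrable).div_const h

theorem integral_diffQuot (hw : Monotone w) (h t : ℝ) :
    ∫ s in 0..t, diffQuot w h s = h⁻¹ * ((∫ s in (t - h)..t, w s) - ∫ s in (-h)..0, w s) := by
  have h2 : Monotone fun s => w (s - h) := fun x y hxy => hw (by linarith)
  have hi : ∀ a b, IntervalIntegrable w volume a b := fun a b => hw.intervalIntegrable
  simp only [diffQuot, div_eq_inv_mul]
  rw [intervalIntegral.integral_const_mul, intervalIntegral.integral_sub (hi _ _)
    h2.intervalIntegrable, intervalIntegral.integral_comp_sub_right (fun s => w s)]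
  congr 1
  rw [zero_sub, intervalIntegral.integral_interval_sub_interval_comm (hi _ _) (hi _ _) (hi _ _)]
  rw [intervalIntegral.integral_symm (-h) 0, intervalIntegral.integral_symm (t - h) t]
  ring

theorem integral_diffQuot_mem (hw : Monotone w) (hw0 : ∀ t ≤ 0, w t = 0) {h : ℝ} (hh : 0 < h)
    (t : ℝ) : ∫ s in 0..t, diffQuot w h s ∈ Icc (w (t - h)) (w t) := by
  have h0 : ∫ s in (-h)..0, w s = 0 := by
    rw [intervalIntegral.integral_congr (g := fun _ => 0)]
    · simp
    · intro s hs
      rw [uIcc_of_le (by linarith)] at hs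
      exact hw0 s hs.2
  rw [integral_diffQuot hw, h0, sub_zero]
  have hle : t - h ≤ t := by linarith
  have h1 : ∫ s in (t - h)..t, w s ≤ ∫ s in (t - h)..t, w t :=
    intervalIntegral.integral_mono_on hle hw.intervalIntegrable intervalIntegrable_const
      fun s hs => hw hs.2
  have h2 : ∫ s in (t - h)..t, w (t - h) ≤ ∫ s in (t - h)..t, w s :=
    intervalIntegral.integral_mono_on hle intervalIntegrable_const hw.intervalIntegrable
      fun s hs => hw hs.1
  rw [intervalIntegral.integral_const, smul_eq_mul, sub_sub_cancel] at h1 h2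
  constructor
  · rw [le_inv_mul_iff₀ hh]; exact h2
  · rw [inv_mul_le_iff₀ hh]; exact h1

theorem integral_diffQuot_sq_le (hw : Monotone w) (hF : Monotone F)
    (hF0 : ∀ t, 0 ≤ F t)
    (hinc : ∀ a b, a ≤ b → (w b - w a) ^ 2 ≤ (b - a) * (F b - F a)) {h : ℝ} (hh : 0 < h) {t : ℝ}
    (ht : 0 ≤ t) : IntervalIntegrable (fun s => diffQuot w h s ^ 2) volume 0 t ∧
    ∫ s in 0..t, diffQuot w h s ^ 2 ≤ F t := by
  have hle : ∀ s, diffQuot w h s ^ 2 ≤ diffQuot F h s := by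
    intro s
    have := hinc (s - h) s (by linarith)
    rw [diffQuot, diffQuot, div_pow, div_le_div_iff₀ (by positivity) hh]
    rw [sub_sub_cancel] at this
    nlinarith
  have hii : IntervalIntegrable (fun s => diffQuot w h s ^ 2) volume 0 t := by
    refine (intervalIntegrable_diffQuot hF h 0 t).mono_fun ?_ ?_
    · have h2 : Monotone fun s => w (s - h) := fun x y hxy => hw (by linarith)
      exact (((hw.measurable.sub h2.measurable).div_const h).pow_const 2).aestronglyMeasurable
    · refine ae_of_all _ fun s => ?_
      change ‖_‖ ≤ ‖_‖
      rw [norm_of_nonneg (sq_nonneg _)]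
      exact (hle s).trans (le_abs_self _)
  refine ⟨hii, ?_⟩
  have h1 : ∫ s in 0..t, diffQuot w h s ^ 2 ≤ ∫ s in 0..t, diffQuot F h s :=
    intervalIntegral.integral_mono_on ht hii (intervalIntegrable_diffQuot hF h 0 t)
      fun s _ => hle s
  refine h1.trans ?_
  rw [integral_diffQuot hF]
  have h2 : ∫ s in (t - h)..t, F s ≤ ∫ s in (t - h)..t, F t :=
    intervalIntegral.integral_mono_on (by linarith) hF.intervalIntegrable intervalIntegrable_const
      fun s hs => hF hs.2
  rw [intervalIntegral.integral_const, smul_eq_mul, sub_sub_cancel] at h2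
  have h3 : 0 ≤ ∫ s in (-h)..0, F s :=
    intervalIntegral.integral_nonneg (by linarith) fun s _ => hF0 s
  rw [inv_mul_le_iff₀ hh]
  linarith

end Profile

end Increments

section ChordDefect

open scoped Pointwise Topology

/-- The Poincaré inequality with constant `Λ` between the `L^p` norm of a primitive with respect to
the exponential distribution and the `L²` norm of its derivative. -/
def ExpPoincare (Λ p : ℝ) : Prop :=
  ∀ (φ : ℝ → ℝ) (t : ℝ), 0 < t → MemLp φ 2 volume → (∀ s, s ∉ Ioc 0 t → φ s = 0) →
    Λ * (∫ s, |∫ x in 0..s, φ x| ^ p ∂expM) ^ (2 / p) ≤ ∫ x, φ x ^ 2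

theorem ae_expM_pos : ∀ᵐ s ∂expM, 0 < s := by
  rw [ae_iff]
  convert! expM_Iic_zero using 2
  ext s
  simp

variable {w F : ℝ → ℝ}

/-- `w` minus its chord on `[0, t]`. -/
def chordDefect (w : ℝ → ℝ) (t s : ℝ) : ℝ := w (min s t) - min s t * (w t / t)

theorem sub_sq_div_ge {Λ p E : ℝ} (hp : 0 < p) (hP : ExpPoincare Λ p) (hw : Monotone w)
    (hw0 : ∀ t ≤ 0, w t = 0) (hF : Monotone F) (hF0 : ∀ t, 0 ≤ F t) (hE : ∀ t, F t ≤ E)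
    (hinc : ∀ a b, a ≤ b → (w b - w a) ^ 2 ≤ (b - a) * (F b - F a)) {t : ℝ} (ht : 0 < t) :
    Λ * (∫ s, |chordDefect w t s| ^ p ∂expM) ^ (2 / p) ≤ F t - w t ^ 2 / t := by
  have hwc := continuous_of_sq_sub_le hF0 hE hinc
  have hwn : ∀ s, 0 ≤ w s := fun s => by
    rcases le_total s 0 with h | h
    · rw [hw0 s h]
    · rw [← hw0 0 le_rfl]; exact hw h
  let h : ℕ → ℝ := fun n => 1 / (n + 1 : ℝ)
  have hh : ∀ n, 0 < h n := fun n => by simp only [h]; positivity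
  have hlim0 : Tendsto h atTop (𝓝 0) := tendsto_one_div_add_atTop_nhds_zero_nat
  let P : ℕ → ℝ → ℝ := fun n s => ∫ x in 0..s, diffQuot w (h n) x
  have hPmem : ∀ n s, P n s ∈ Icc (w (s - h n)) (w s) := fun n s =>
    integral_diffQuot_mem hw hw0 (hh n) s
  have hPlim : ∀ s, Tendsto (fun n => P n s) atTop (𝓝 (w s)) := by
    intro s
    refine tendsto_of_tendsto_of_tendsto_of_le_of_le ?_ tendsto_const_nhds
      (fun n => (hPmem n s).1) (fun n => (hPmem n s).2)
    have : Tendsto (fun n => s - h n) atTop (𝓝 (s - 0)) := tendsto_const_nhds.sub hlim0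
    rw [sub_zero] at this
    exact (hwc.tendsto s).comp this
  let φ : ℕ → ℝ → ℝ := fun n => (Ioc 0 t).indicator fun s => diffQuot w (h n) s - P n t / t
  have hii := fun n a b => intervalIntegrable_diffQuot hw (h n) a b
  have hφm : ∀ n, Measurable (φ n) := by
    intro n
    have h2 : Monotone fun s => w (s - h n) := fun x y hxy => hw (by linarith)
    exact (((hw.measurable.sub h2.measurable).div_const (h n)).sub_const _).indicator
      measurableSet_Ioc
  have hsq : ∀ n, IntervalIntegrable (fun s => (diffQuot w (h n) s - P n t / t) ^ 2) volume 0 t ∧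
      ∫ s in 0..t, (diffQuot w (h n) s - P n t / t) ^ 2 ≤ F t - P n t ^ 2 / t := by
    intro n
    obtain ⟨h1, h2⟩ := integral_diffQuot_sq_le hw hF hF0 hinc (hh n) ht.le
    set c := P n t / t
    have e : (fun s => (diffQuot w (h n) s - c) ^ 2) =
        fun s => diffQuot w (h n) s ^ 2 - 2 * c * diffQuot w (h n) s + c ^ 2 := by
      ext s; ring
    rw [e]
    have h3 := (hii n 0 t).const_mul (2 * c)
    refine ⟨(h1.sub h3).add intervalIntegrable_const, ?_⟩
    rw [intervalIntegral.integral_add (h1.sub h3) intervalIntegrable_const,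
      intervalIntegral.integral_sub h1 h3, intervalIntegral.integral_const_mul,
      intervalIntegral.integral_const]
    have h4 : 2 * c * P n t = 2 * (P n t ^ 2 / t) := by simp only [c]; ring
    have h5 : (t - 0) • c ^ 2 = P n t ^ 2 / t := by
      simp only [c, smul_eq_mul, sub_zero]; field_simp
    change _ - 2 * c * P n t + _ ≤ _
    rw [h4, h5]
    linarith
  have hφsq : ∀ n, (fun s => φ n s ^ 2) =
      (Ioc 0 t).indicator fun s => (diffQuot w (h n) s - P n t / t) ^ 2 := by
    intro n
    ext s
    simp only [φ, indicator]
    split_ifs <;> simp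
  have hφint : ∀ n, ∫ s, φ n s ^ 2 ≤ F t - P n t ^ 2 / t := by
    intro n
    rw [hφsq n, integral_indicator measurableSet_Ioc, ← intervalIntegral.integral_of_le ht.le]
    exact (hsq n).2
  have hφL : ∀ n, MemLp (φ n) 2 volume := by
    intro n
    rw [memLp_two_iff_integrable_sq (hφm n).aestronglyMeasurable, hφsq n,
      integrable_indicator_iff measurableSet_Ioc,
      ← intervalIntegrable_iff_integrableOn_Ioc_of_le ht.le]
    exact (hsq n).1
  have hprim : ∀ n s, 0 < s → ∫ x in 0..s, φ n x = P n (min s t) - min s t * (P n t / t) := by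
    intro n s hs
    have hm : 0 ≤ min s t := le_min hs.le ht.le
    rw [intervalIntegral.integral_of_le hs.le, setIntegral_indicator measurableSet_Ioc,
      Ioc_inter_Ioc, sup_idem, ← intervalIntegral.integral_of_le hm,
      intervalIntegral.integral_sub (hii _ _ _) intervalIntegrable_const,
      intervalIntegral.integral_const, smul_eq_mul, sub_zero]
  have hineq : ∀ n, Λ * (∫ s, |P n (min s t) - min s t * (P n t / t)| ^ p ∂expM) ^ (2 / p) ≤
      F t - P n t ^ 2 / t := by
    intro n
    have := hP (φ n) t ht (hφL n) (fun s hs => indicator_of_notMem hs _)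
    have e : ∫ s, |∫ x in 0..s, φ n x| ^ p ∂expM =
        ∫ s, |P n (min s t) - min s t * (P n t / t)| ^ p ∂expM := by
      refine integral_congr_ae ?_
      filter_upwards [ae_expM_pos] with s hs
      rw [hprim n s hs]
    rw [e] at this
    exact this.trans (hφint n)
  have hPm : ∀ n, Measurable (P n) := fun n =>
    (intervalIntegral.continuous_primitive (hii n) 0).measurable
  have hIlim : Tendsto (fun n => ∫ s, |P n (min s t) - min s t * (P n t / t)| ^ p ∂expM) atTop
      (𝓝 (∫ s, |chordDefect w t s| ^ p ∂expM)) := by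
    refine tendsto_integral_of_dominated_convergence (fun _ => (2 * w t) ^ p) ?_
      (integrable_const _) ?_ ?_
    · intro n
      have := (hPm n).comp (measurable_id.min measurable_const : Measurable fun s : ℝ => min s t)
      have h2 : Measurable fun s => |P n (min s t) - min s t * (P n t / t)| ^ p := by
        refine (Measurable.sub this ?_).abs.pow_const p
        exact (measurable_id.min measurable_const).mul_const _
      exact h2.aestronglyMeasurable
    · intro n
      filter_upwards [ae_expM_pos] with s hs
      rw [norm_of_nonneg (by positivity)]
      refine rpow_le_rpow (abs_nonneg _) ?_ hp.le
      have h1 := hPmem n (min s t)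
      have h2 := hPmem n t
      have h3 : w (min s t) ≤ w t := hw (min_le_right _ _)
      have h4 := (hwn _).trans h1.1
      have h5 := (hwn _).trans h2.1
      have hm : 0 ≤ min s t := le_min hs.le ht.le
      have h6 : 0 ≤ min s t * (P n t / t) := by positivity
      have h7 : min s t * (P n t / t) ≤ P n t := by
        rw [mul_div_assoc', div_le_iff₀ ht, mul_comm]
        exact mul_le_mul_of_nonneg_left (min_le_right _ _) h5
      rw [abs_le]
      constructor <;> linarith [h1.2, h2.2]
    · refine ae_of_all _ fun s => ?_
      have := (hPlim (min s t)).sub (((hPlim t).div_const t).const_mul (min s t))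
      exact (this.abs).rpow_const (Or.inr hp.le)
  refine le_of_tendsto_of_tendsto' ((hIlim.rpow_const (Or.inr (by positivity))).const_mul Λ) ?_
    hineq
  exact tendsto_const_nhds.sub (((hPlim t).pow 2).div_const t)

end ChordDefect

section EnergyDefect

open scoped Pointwise Topology

variable {w F : ℝ → ℝ}

theorem memLp_id_expM {p : ℝ} (hp : 0 < p) : MemLp (fun s : ℝ => s) (ENNReal.ofReal p) expM := by
  rw [← integrable_norm_rpow_iff (by fun_prop) (by simpa using hp) ENNReal.ofReal_ne_top,
    ENNReal.toReal_ofReal hp.le]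
  have hm : Measurable fun t : ℝ => ENNReal.ofReal (exp (-t)) := by fun_prop
  rw [expM, integrable_withDensity_iff hm (ae_of_all _ fun _ => ENNReal.ofReal_lt_top)]
  have := Real.GammaIntegral_convergent (s := p + 1) (by linarith)
  refine this.congr_fun (fun x hx => ?_) measurableSet_Ioi
  rw [mem_Ioi] at hx
  simp only
  rw [ENNReal.toReal_ofReal (exp_pos _).le, norm_of_nonneg hx.le, add_sub_cancel_right, mul_comm]

theorem toReal_eLpNorm_ofReal {μ : Measure ℝ} {p : ℝ} (hp : 0 < p) {f : ℝ → ℝ}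
    (hf : MemLp f (ENNReal.ofReal p) μ) :
    (eLpNorm f (ENNReal.ofReal p) μ).toReal = (∫ s, |f s| ^ p ∂μ) ^ (1 / p) := by
  rw [hf.eLpNorm_eq_integral_rpow_norm (by simpa using hp) ENNReal.ofReal_ne_top,
    ENNReal.toReal_ofReal (by positivity), ENNReal.toReal_ofReal hp.le, one_div]
  rfl

/-- Minkowski's inequality for dominated functions. -/
theorem rpow_integral_le_add {μ : Measure ℝ} {p c : ℝ} (hp : 1 ≤ p) (hc : 0 ≤ c) {f g k : ℝ → ℝ}
    (hk : AEStronglyMeasurable k μ)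
    (hf : MemLp f (ENNReal.ofReal p) μ) (hg : MemLp g (ENNReal.ofReal p) μ)
    (h : ∀ᵐ s ∂μ, |k s| ≤ |f s| + c * |g s|) :
    (∫ s, |k s| ^ p ∂μ) ^ (1 / p) ≤
      (∫ s, |f s| ^ p ∂μ) ^ (1 / p) + c * (∫ s, |g s| ^ p ∂μ) ^ (1 / p) := by
  have hp0 : 0 < p := by linarith
  have hp1 : 1 ≤ ENNReal.ofReal p := by rw [← ENNReal.ofReal_one]; exact ENNReal.ofReal_le_ofReal hp
  have hf' := hf.norm
  have hg' := (hg.norm).const_mul c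
  have hle : ∀ᵐ s ∂μ, ‖k s‖ ≤ ‖((fun s => ‖f s‖) + fun s => c * ‖g s‖) s‖ := by
    filter_upwards [h] with s hs
    exact hs.trans (le_abs_self _)
  have hk' : MemLp k (ENNReal.ofReal p) μ := (hf'.add hg').mono hk hle
  rw [← toReal_eLpNorm_ofReal hp0 hk', ← toReal_eLpNorm_ofReal hp0 hf, ← toReal_eLpNorm_ofReal hp0 hg]
  have h1 : eLpNorm k (ENNReal.ofReal p) μ ≤
      eLpNorm (fun s => ‖f s‖) (ENNReal.ofReal p) μ +
        eLpNorm (fun s => c * ‖g s‖) (ENNReal.ofReal p) μ := by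
    exact le_trans (eLpNorm_mono_ae hle) (eLpNorm_add_le hf'.1 hg'.1 hp1)
  have h2 : eLpNorm (fun s => c * ‖g s‖) (ENNReal.ofReal p) μ =
      ENNReal.ofReal c * eLpNorm g (ENNReal.ofReal p) μ := by
    have := eLpNorm_const_smul (μ := μ) c (fun s => ‖g s‖) (ENNReal.ofReal p)
    rw [eLpNorm_norm, Real.enorm_of_nonneg hc] at this
    exact this
  rw [h2, eLpNorm_norm] at h1
  have := ENNReal.toReal_mono (ENNReal.add_ne_top.2 ⟨hf.2.ne,
    ENNReal.mul_ne_top ENNReal.ofReal_ne_top hg.2.ne⟩) h1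
  rwa [ENNReal.toReal_add hf.2.ne (ENNReal.mul_ne_top ENNReal.ofReal_ne_top hg.2.ne),
    ENNReal.toReal_mul, ENNReal.toReal_ofReal hc] at this

theorem rpow_two_div {x p : ℝ} (hx : 0 ≤ x) : x ^ (2 / p) = (x ^ (1 / p)) ^ 2 := by
  rw [← rpow_natCast, ← rpow_mul hx]; congr 1; push_cast; ring

theorem rpow_integral_le_chordDefect {p E : ℝ} (hp : 1 ≤ p) (hw : Monotone w)
    (hw0 : ∀ t ≤ 0, w t = 0) (hF0 : ∀ t, 0 ≤ F t) (hE : ∀ t, F t ≤ E)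
    (hinc : ∀ a b, a ≤ b → (w b - w a) ^ 2 ≤ (b - a) * (F b - F a)) {t : ℝ} (ht : 0 < t) :
    (∫ s, |w s| ^ p ∂expM) ^ (1 / p) ≤ (∫ s, |chordDefect w t s| ^ p ∂expM) ^ (1 / p) +
      √(E / t) * (∫ s, |s| ^ p ∂expM) ^ (1 / p) := by
  have hwc := continuous_of_sq_sub_le hF0 hE hinc
  have hE0 : 0 ≤ E := (hF0 0).trans (hE 0)
  have hwn : ∀ s, 0 ≤ w s := fun s => by
    rcases le_total s 0 with h | h
    · rw [hw0 s h]
    · rw [← hw0 0 le_rfl]; exact hw h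
  have hwE : ∀ s, 0 ≤ s → w s ^ 2 ≤ s * E := by
    intro s hs
    have := hinc 0 s hs
    rw [hw0 0 le_rfl, sub_zero, sub_zero] at this
    exact this.trans (mul_le_mul_of_nonneg_left (by linarith [hF0 0, hE s]) hs)
  have hzc : Continuous (chordDefect w t) := by unfold chordDefect; fun_prop
  have hzb : ∀ᵐ s ∂expM, ‖chordDefect w t s‖ ≤ 2 * w t := by
    filter_upwards [ae_expM_pos] with s hs
    have hm : 0 ≤ min s t := le_min hs.le ht.le
    have h3 : w (min s t) ≤ w t := hw (min_le_right _ _)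
    have h4 := hwn (min s t)
    have h5 := hwn t
    have h6 : 0 ≤ min s t * (w t / t) := by positivity
    have h7 : min s t * (w t / t) ≤ w t := by
      rw [mul_div_assoc', div_le_iff₀ ht, mul_comm]
      exact mul_le_mul_of_nonneg_left (min_le_right _ _) h5
    rw [Real.norm_eq_abs, chordDefect, abs_le]
    constructor <;> linarith
  refine rpow_integral_le_add hp (sqrt_nonneg _) hwc.aestronglyMeasurable
    (MemLp.of_bound hzc.aestronglyMeasurable _ hzb) (memLp_id_expM (by linarith)) ?_
  filter_upwards [ae_expM_pos] with s hs
  suffices |w s - chordDefect w t s| ≤ √(E / t) * |s| by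
    have h1 := abs_add_le (chordDefect w t s) (w s - chordDefect w t s)
    rw [add_sub_cancel] at h1
    linarith
  rw [abs_of_pos hs]
  rw [← sqrt_sq hs.le, ← sqrt_mul (by positivity), sqrt_sq hs.le]
  apply abs_le_sqrt
  rcases le_total s t with hst | hst
  · have h1 := hwE t ht.le
    rw [chordDefect, min_eq_left hst, sub_sub_cancel, mul_pow, div_pow, mul_comm]
    refine mul_le_mul_of_nonneg_right ?_ (sq_nonneg s)
    rw [div_le_div_iff₀ (by positivity) ht]
    nlinarith
  · have h1 := hwE s hs.le
    rw [chordDefect, min_eq_right hst, mul_div_cancel₀ _ ht.ne', sub_self, sub_zero]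
    refine h1.trans ?_
    rw [div_mul_eq_mul_div, le_div_iff₀ ht]
    nlinarith [mul_nonneg hE0 hs.le]

theorem exists_energy_defect_bound {Λ p θ : ℝ} (hp : 1 ≤ p) (hΛ : 0 ≤ Λ) (hP : ExpPoincare Λ p)
    (hθ : 0 ≤ θ) (hθ1 : θ < 1) :
    ∃ C : ℝ, 0 ≤ C ∧ ∀ (w F : ℝ → ℝ) (E : ℝ), Monotone w → (∀ t ≤ 0, w t = 0) → Monotone F →
      (∀ t, 0 ≤ F t) → (∀ t, F t ≤ E) →
      (∀ a b, a ≤ b → (w b - w a) ^ 2 ≤ (b - a) * (F b - F a)) →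
      E ≤ 1 + θ * Λ * (∫ s, |w s| ^ p ∂expM) ^ (2 / p) →
      ∀ t, 0 < t → E - F t ≤ 1 + C / t - w t ^ 2 / t := by
  set G := (∫ s, |s| ^ p ∂expM) ^ (1 / p) with hG
  set K := 1 + 2 / (1 - θ) with hK
  have hθ' : 0 < 1 - θ := by linarith
  have hK0 : 0 ≤ K := by positivity
  set D := K * Λ * G ^ 2 with hD
  have hD0 : 0 ≤ D := by positivity
  refine ⟨D * (4 / (1 - θ)), by positivity, ?_⟩
  intro w F E hw hw0 hF hF0 hE hinc hcon
  have hE0 : 0 ≤ E := (hF0 0).trans (hE 0)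
  have key : ∀ t, 0 < t → E ≤ 1 + (1 + θ) / 2 * (F t - w t ^ 2 / t) + D * E / t ∧
      0 ≤ F t - w t ^ 2 / t := by
    intro t ht
    have h1 := sub_sq_div_ge (by linarith) hP hw hw0 hF hF0 hE hinc ht
    have h2 := rpow_integral_le_chordDefect hp hw hw0 hF0 hE hinc ht
    have i0 : 0 ≤ ∫ s, |w s| ^ p ∂expM := integral_nonneg fun s => by positivity
    have i1 : 0 ≤ ∫ s, |chordDefect w t s| ^ p ∂expM := integral_nonneg fun s => by positivity
    rw [rpow_two_div i0] at hcon
    rw [rpow_two_div i1] at h1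
    rw [← hG] at h2
    have hz : 0 ≤ (∫ s, |chordDefect w t s| ^ p ∂expM) ^ (1 / p) := by positivity
    have ha : 0 ≤ (∫ s, |w s| ^ p ∂expM) ^ (1 / p) := by positivity
    set z := (∫ s, |chordDefect w t s| ^ p ∂expM) ^ (1 / p)
    set α := (∫ s, |w s| ^ p ∂expM) ^ (1 / p)
    set y := √(E / t) * G with hy
    have hy2 : y ^ 2 = E / t * G ^ 2 := by rw [hy, mul_pow, sq_sqrt (by positivity)]
    have h3 : α ^ 2 ≤ (z + y) ^ 2 := pow_le_pow_left₀ ha h2 2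
    have h4 : θ * (z + y) ^ 2 ≤ (1 + θ) / 2 * z ^ 2 + K * y ^ 2 := by
      have e : 2 * z * y ≤ (1 - θ) / 2 * z ^ 2 + 2 / (1 - θ) * y ^ 2 := by
        have : 0 ≤ ((1 - θ) * z - 2 * y) ^ 2 / (2 * (1 - θ)) := by positivity
        have e2 : ((1 - θ) * z - 2 * y) ^ 2 / (2 * (1 - θ)) =
            (1 - θ) / 2 * z ^ 2 + 2 / (1 - θ) * y ^ 2 - 2 * z * y := by field_simp; ring
        linarith
      have e3 : θ * (2 * z * y + y ^ 2) ≤ 2 / (1 - θ) * y ^ 2 + y ^ 2 + (1 - θ) / 2 * z ^ 2 := by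
        rcases le_total 0 (2 * z * y + y ^ 2) with h | h
        · nlinarith
        · have : 0 ≤ 2 / (1 - θ) * y ^ 2 + y ^ 2 + (1 - θ) / 2 * z ^ 2 := by positivity
          nlinarith
      rw [hK]; linarith
    have h5 : θ * Λ * α ^ 2 ≤ (1 + θ) / 2 * (Λ * z ^ 2) + D * E / t := by
      have : D * E / t = K * y ^ 2 * Λ := by rw [hy2, hD]; ring
      rw [this]
      have := mul_le_mul_of_nonneg_left h3 hθ
      have := mul_le_mul_of_nonneg_left (this.trans h4) hΛ
      linarith
    have h6 : (1 + θ) / 2 * (Λ * z ^ 2) ≤ (1 + θ) / 2 * (F t - w t ^ 2 / t) :=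
      mul_le_mul_of_nonneg_left h1 (by linarith)
    exact ⟨by linarith, le_trans (by positivity) h1⟩
  have hEb : E ≤ 4 / (1 - θ) := by
    set t₀ := 4 * D / (1 - θ) + 1 with ht₀
    have ht0 : 0 < t₀ := by positivity
    obtain ⟨h1, h2⟩ := key t₀ ht0
    have h3 : F t₀ - w t₀ ^ 2 / t₀ ≤ E := by
      have : 0 ≤ w t₀ ^ 2 / t₀ := by positivity
      linarith [hE t₀]
    have h4 : D * E / t₀ ≤ (1 - θ) / 4 * E := by
      rw [div_le_iff₀ ht0, ht₀]
      have : (1 - θ) / 4 * E * (4 * D / (1 - θ) + 1) = D * E + (1 - θ) / 4 * E := by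
        field_simp
      rw [this]
      have : 0 ≤ (1 - θ) / 4 * E := by positivity
      linarith
    have h5 : (1 + θ) / 2 * (F t₀ - w t₀ ^ 2 / t₀) ≤ (1 + θ) / 2 * E :=
      mul_le_mul_of_nonneg_left h3 (by linarith)
    rw [le_div_iff₀ hθ']
    linarith
  intro t ht
  obtain ⟨h1, h2⟩ := key t ht
  have h3 : D * E / t ≤ D * (4 / (1 - θ)) / t := by gcongr
  have h4 : (1 + θ) / 2 * (F t - w t ^ 2 / t) ≤ 1 * (F t - w t ^ 2 / t) :=
    mul_le_mul_of_nonneg_right (by linarith) h2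
  linarith

end EnergyDefect

section Moser

open scoped Pointwise Topology

variable {w F : ℝ → ℝ}

theorem sub_le_of_small_defect {E C L : ℝ} (hC : 0 ≤ C) (hL : 0 ≤ L)
    (hE : ∀ t, F t ≤ E) (hinc : ∀ a b, a ≤ b → (w b - w a) ^ 2 ≤ (b - a) * (F b - F a))
    (hd : ∀ t, 0 < t → E - F t ≤ 1 + C / t - w t ^ 2 / t) {a b : ℝ} (ha0 : 0 < a)
    (ha : 4 * (L + C) ≤ a) (hab : a ≤ b) (hLa : a - w a ^ 2 ≤ L) (hLb : b - w b ^ 2 ≤ L) :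
    b - a ≤ 12 * (L + C) := by
  set M := L + C with hM
  have hM0 : 0 ≤ M := by positivity
  set d := b - a with hdd
  have hd0 : 0 ≤ d := by linarith
  have hda := hd a ha0
  have hCa : C / a ≤ 1 / 4 := by rw [div_le_div_iff₀ ha0 (by norm_num)]; linarith
  have hMa : M / a ≤ 1 / 4 := by rw [div_le_div_iff₀ ha0 (by norm_num)]; linarith
  have hMa0 : 0 ≤ M / a := by positivity
  have e1 : w a ^ 2 ≤ 5 / 4 * a := by
    have h1 : w a ^ 2 / a ≤ 5 / 4 := by linarith [hE a]
    rwa [div_le_iff₀ ha0] at h1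
  have e1' : w a ^ 2 ≤ a + C := by
    have h1 : w a ^ 2 / a ≤ 1 + C / a := by linarith [hE a]
    rw [div_le_iff₀ ha0, add_mul, div_mul_cancel₀ _ ha0.ne'] at h1
    linarith
  have e2 : E - F a ≤ M / a := by
    have : M / a = L / a + C / a := by rw [hM, add_div]
    have h2 : 1 - w a ^ 2 / a ≤ L / a := by
      have : 1 - w a ^ 2 / a = (a - w a ^ 2) / a := by field_simp
      rw [this]; gcongr
    linarith
  have e3 : (w b - w a) ^ 2 ≤ d * (M / a) :=
    (hinc a b hab).trans (mul_le_mul_of_nonneg_left (by linarith [hE b]) hd0)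
  set x := w b - w a with hx
  have e4 : b - L ≤ w a ^ 2 + 2 * w a * x + x ^ 2 := by
    have : w b = w a + x := by rw [hx]; ring
    rw [this] at hLb
    nlinarith
  have e5 : x ^ 2 ≤ d / 4 := e3.trans (by nlinarith)
  have e6 : 2 * w a * x ≤ 5 * M + d / 4 := by
    have h1 : (w a * x) ^ 2 ≤ 5 / 4 * (d * M) := by
      calc (w a * x) ^ 2 = w a ^ 2 * x ^ 2 := by ring
        _ ≤ (5 / 4 * a) * (d * (M / a)) := by gcongr
        _ = 5 / 4 * (d * M) := by field_simp
    have h2 : (2 * (w a * x)) ^ 2 ≤ (5 * M + d / 4) ^ 2 := by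
      nlinarith [sq_nonneg (5 * M - d / 4)]
    have := abs_le_of_sq_le_sq' h2 (by positivity)
    linarith [this.2]
  linarith

theorem volume_small_defect_le {E C L : ℝ} (hC : 0 ≤ C) (hL : 0 ≤ L)
    (hE : ∀ t, F t ≤ E) (hinc : ∀ a b, a ≤ b → (w b - w a) ^ 2 ≤ (b - a) * (F b - F a))
    (hd : ∀ t, 0 < t → E - F t ≤ 1 + C / t - w t ^ 2 / t) :
    volume {t | 0 < t ∧ t - w t ^ 2 ≤ L} ≤ ENNReal.ofReal (16 * (L + C)) := by
  have hM0 : 0 ≤ L + C := by positivity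
  set S := {t | 0 < t ∧ t - w t ^ 2 ≤ L} with hS
  have hsub : S ⊆ Ioo 0 (4 * (L + C)) ∪ (S ∩ Ici (4 * (L + C))) := by
    intro t ht
    rcases lt_or_ge t (4 * (L + C)) with h | h
    · exact Or.inl ⟨ht.1, h⟩
    · exact Or.inr ⟨ht, h⟩
  have h2 : volume (S ∩ Ici (4 * (L + C))) ≤ ENNReal.ofReal (12 * (L + C)) := by
    refine (Real.volume_le_diam _).trans (Metric.ediam_le ?_)
    have key : ∀ a ∈ S ∩ Ici (4 * (L + C)), ∀ b ∈ S ∩ Ici (4 * (L + C)), a ≤ b →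
        b - a ≤ 12 * (L + C) := fun a ha b hb hab =>
      sub_le_of_small_defect hC hL hE hinc hd ha.1.1 ha.2 hab ha.1.2 hb.1.2
    intro a ha b hb
    rw [edist_dist, Real.dist_eq]
    apply ENNReal.ofReal_le_ofReal
    rcases le_total a b with h | h
    · rw [abs_sub_comm, abs_of_nonneg (by linarith)]; exact key a ha b hb h
    · rw [abs_of_nonneg (by linarith)]; exact key b hb a ha h
  refine (measure_mono hsub).trans ((measure_union_le _ _).trans ?_)
  rw [Real.volume_Ioo]
  refine (add_le_add_right h2 _).trans ?_
  rw [← ENNReal.ofReal_add (by linarith) (by linarith)]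
  apply le_of_eq; congr 1; ring

theorem exists_lintegral_exp_sq_le {C : ℝ} (hC : 0 ≤ C) :
    ∃ B : ℝ, 0 ≤ B ∧ ∀ (w F : ℝ → ℝ) (E : ℝ), Monotone w →
      (∀ t, F t ≤ E) → (∀ a b, a ≤ b → (w b - w a) ^ 2 ≤ (b - a) * (F b - F a)) →
      (∀ t, 0 < t → E - F t ≤ 1 + C / t - w t ^ 2 / t) →
      ∫⁻ s, ENNReal.ofReal (exp (w s ^ 2)) ∂expM ≤ ENNReal.ofReal B := by
  let c : ℕ → ℝ := fun k => exp C * exp (-(k : ℝ)) * (16 * ((k + 1 : ℝ) + C))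
  have hc0 : ∀ k, 0 ≤ c k := fun k => by simp only [c]; positivity
  have hcs : Summable c := by
    have h0 := Real.summable_pow_mul_exp_neg_nat_mul 0 one_pos
    have h1 := Real.summable_pow_mul_exp_neg_nat_mul 1 one_pos
    refine ((h1.mul_left (16 * exp C)).add (h0.mul_left (16 * exp C * (1 + C)))).congr ?_
    intro k
    simp only [c, neg_mul, one_mul, pow_one, pow_zero]
    ring
  refine ⟨∑' k, c k, tsum_nonneg hc0, ?_⟩
  intro w F E hw hE hinc hd
  rw [lintegral_expM]
  let T : ℕ → Set ℝ := fun k => {t | 0 < t ∧ t - w t ^ 2 ≤ k + 1}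
  have hT : ∀ k, MeasurableSet (T k) := by
    intro k
    exact (measurableSet_lt measurable_const measurable_id).inter
      (measurableSet_le (measurable_id.sub (hw.measurable.pow_const 2)) measurable_const)
  have hpt : ∀ t ∈ Ioi (0 : ℝ), ENNReal.ofReal (exp (-t)) * ENNReal.ofReal (exp (w t ^ 2)) ≤
      ∑' k : ℕ, (T k).indicator (fun _ => ENNReal.ofReal (exp C * exp (-(k : ℝ)))) t := by
    intro t ht
    rw [mem_Ioi] at ht
    have hq : 0 ≤ t - w t ^ 2 + C := by
      have h1 : w t ^ 2 / t ≤ 1 + C / t := by linarith [hE t, hd t ht]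
      rw [div_le_iff₀ ht, add_mul, div_mul_cancel₀ _ ht.ne'] at h1
      linarith
    refine le_trans ?_ (ENNReal.le_tsum ⌊t - w t ^ 2 + C⌋₊)
    rw [indicator_of_mem, ← ENNReal.ofReal_mul (exp_pos _).le, ← exp_add, ← exp_add]
    · apply ENNReal.ofReal_le_ofReal
      apply exp_le_exp.2
      linarith [Nat.floor_le hq]
    · exact ⟨ht, by linarith [Nat.lt_floor_add_one (t - w t ^ 2 + C)]⟩
  refine (setLIntegral_mono_ae' measurableSet_Ioi (ae_of_all _ hpt)).trans ?_
  refine (setLIntegral_le_lintegral _ _).trans ?_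
  rw [lintegral_tsum fun k => (measurable_const.indicator (hT k)).aemeasurable,
    ENNReal.ofReal_tsum_of_nonneg hc0 hcs]
  refine ENNReal.tsum_le_tsum fun k => ?_
  rw [lintegral_indicator_const (hT k)]
  simp only [c]
  rw [ENNReal.ofReal_mul (p := exp C * exp (-(k : ℝ))) (by positivity)]
  refine mul_le_mul_right ?_ _
  exact volume_small_defect_le hC (by positivity) hE hinc hd

end Moser

section RadialLift

open scoped Pointwise Topology

theorem integral_expM (f : ℝ → ℝ) : ∫ t, f t ∂expM = ∫ t in Ioi 0, exp (-t) * f t := by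
  rw [expM, integral_withDensity_eq_integral_toReal_smul (by fun_prop)
    (ae_of_all _ fun _ => ENNReal.ofReal_lt_top)]
  refine integral_congr_ae (ae_of_all _ fun t => ?_)
  simp only [ENNReal.toReal_ofReal (exp_pos _).le, smul_eq_mul]

theorem map_log_ball {R : ℝ} (hR : 0 < R) :
    (volume.restrict (Metric.ball (0 : E2) R)).map (fun x => log (R ^ 2) - log (‖x‖ ^ 2)) =
      ENNReal.ofReal (π * R ^ 2) • expM := by
  have hm : Measurable fun x : E2 => log (R ^ 2) - log (‖x‖ ^ 2) := by fun_prop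
  have hball : ∀ r, 0 ≤ r → volume (Metric.ball (0 : E2) r) = ENNReal.ofReal (π * r ^ 2) := by
    intro r hr
    rw [← volume_toReal_ball_E2 r hr 0, ENNReal.ofReal_toReal measure_ball_lt_top.ne]
  have hfin : IsFiniteMeasure (volume.restrict (Metric.ball (0 : E2) R)) :=
    ⟨by rw [Measure.restrict_apply_univ]; exact measure_ball_lt_top⟩
  have hf2 : IsFiniteMeasure (ENNReal.ofReal (π * R ^ 2) • expM) :=
    ⟨by rw [Measure.smul_apply, measure_univ]; simp⟩
  have hne : ∀ᵐ x : E2 ∂volume, x ≠ 0 := by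
    rw [ae_iff]; simp
  apply measure_ext_of_Ioi
  · rw [Measure.map_apply hm MeasurableSet.univ, preimage_univ, Measure.restrict_apply_univ,
      Measure.smul_apply, measure_univ, hball R hR.le]
    simp
  · rw [Measure.map_apply hm measurableSet_Iio, Measure.restrict_apply (hm measurableSet_Iio)]
    rw [← nonpos_iff_eq_zero, ← measure_singleton (μ := volume) (0 : E2)]
    apply measure_mono
    intro x hx
    by_contra h0
    have hx0 : 0 < ‖x‖ := norm_pos_iff.2 h0
    have h1 : log (R ^ 2) - log (‖x‖ ^ 2) < 0 := hx.1
    have h2 : ‖x‖ < R := by simpa using hx.2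
    have := log_le_log (by positivity) (pow_le_pow_left₀ hx0.le h2.le 2)
    linarith
  · rw [Measure.smul_apply, smul_eq_mul]
    have : expM (Iio 0) = 0 :=
      nonpos_iff_eq_zero.1 ((measure_mono Iio_subset_Iic_self).trans_eq expM_Iic_zero)
    simp [this]
  · intro s hs
    rw [Measure.map_apply hm measurableSet_Ioi, Measure.restrict_apply (hm measurableSet_Ioi),
      Measure.smul_apply, expM_Ioi hs, smul_eq_mul, ← ENNReal.ofReal_mul (by positivity)]
    have e : π * R ^ 2 * exp (-s) = π * (R * exp (-s / 2)) ^ 2 := by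
      rw [mul_pow, ← exp_nat_mul, mul_assoc]; congr 3; push_cast; ring
    rw [e, ← hball _ (by positivity)]
    apply measure_congr
    filter_upwards [hne] with x hx
    have hx0 : 0 < ‖x‖ := norm_pos_iff.2 hx
    have hle : R * exp (-s / 2) ≤ R := by
      have : exp (-s / 2) ≤ 1 := exp_le_one_iff.2 (by linarith)
      nlinarith
    have key : s < log (R ^ 2) - log (‖x‖ ^ 2) ↔ ‖x‖ < R * exp (-s / 2) := by
      rw [← log_lt_log_iff hx0 (by positivity), log_mul hR.ne' (exp_pos _).ne', log_exp, log_pow,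
        log_pow]
      push_cast
      constructor <;> intro h <;> linarith
    apply propext
    change (s < log (R ^ 2) - log (‖x‖ ^ 2) ∧ x ∈ Metric.ball (0 : E2) R) ↔
      x ∈ Metric.ball (0 : E2) (R * exp (-s / 2))
    rw [key, mem_ball_zero_iff, mem_ball_zero_iff]
    exact ⟨fun h => h.1, fun h => ⟨h, h.trans_le hle⟩⟩

/-- The radial function whose profile in the variable `log (R² / ‖x‖²)` is the primitive of `φ`,
extended to the origin by the value of the primitive at `S`. -/
def radialLift (φ : ℝ → ℝ) (R S r : ℝ) : ℝ :=
  if r ≤ 0 then ∫ x in 0..S, φ x else ∫ x in 0..(log (R ^ 2) - log r), φ x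

section Lift

variable {φ : ℝ → ℝ} {R S ε : ℝ}

theorem contDiff_primitive (hφ : ContDiff ℝ (⊤ : ℕ∞) φ) :
    ContDiff ℝ (⊤ : ℕ∞) fun s => ∫ x in 0..s, φ x := by
  have hd : ∀ s, HasDerivAt (fun s => ∫ x in 0..s, φ x) (φ s) s := fun s =>
    intervalIntegral.integral_hasDerivAt_right (hφ.continuous.intervalIntegrable _ _)
      hφ.continuous.stronglyMeasurable.stronglyMeasurableAtFilter hφ.continuous.continuousAt
  rw [contDiff_infty_iff_deriv]
  refine ⟨fun s => (hd s).differentiableAt, ?_⟩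
  rwa [show deriv (fun s => ∫ x in 0..s, φ x) = φ from funext fun s => (hd s).deriv]

theorem contDiff_radialLift (hφ : ContDiff ℝ (⊤ : ℕ∞) φ) (hR : 0 < R)
    (hS : ∀ s, S ≤ s → φ s = 0) : ContDiff ℝ (⊤ : ℕ∞) (radialLift φ R S) := by
  rw [contDiff_iff_contDiffAt]
  intro r
  rcases lt_or_ge 0 r with hr | hr
  · have h1 : ContDiffAt ℝ (⊤ : ℕ∞) (fun r => ∫ x in 0..(log (R ^ 2) - log r), φ x) r :=
      (contDiff_primitive hφ).contDiffAt.comp r (contDiffAt_const.sub (contDiffAt_log.2 hr.ne'))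
    refine h1.congr_of_eventuallyEq ?_
    filter_upwards [lt_mem_nhds hr] with x hx
    rw [radialLift, if_neg (not_le.2 hx)]
  · refine (contDiffAt_const (c := ∫ x in 0..S, φ x)).congr_of_eventuallyEq ?_
    have hlt : r < R ^ 2 * exp (-S) := hr.trans_lt (by positivity)
    filter_upwards [gt_mem_nhds hlt] with x hx
    rw [radialLift]
    split_ifs with h
    · rfl
    · push Not at h
      have h2 : S ≤ log (R ^ 2) - log x := by
        have := log_le_log h hx.le
        rw [log_mul (by positivity) (exp_pos _).ne', log_exp] at this
        linarith
      rw [← intervalIntegral.integral_add_adjacent_intervals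
        (hφ.continuous.intervalIntegrable 0 S) (hφ.continuous.intervalIntegrable S _)]
      rw [intervalIntegral.integral_congr (a := S) (g := fun _ => 0)]
      · simp
      · intro s hs
        rw [uIcc_of_le h2] at hs
        exact hS s hs.1

theorem radialLift_eq_zero (hε : ∀ s, s ≤ ε → φ s = 0) (hε0 : 0 < ε) (hR : 0 < R) {r : ℝ}
    (hr : R ^ 2 * exp (-ε) ≤ r) : radialLift φ R S r = 0 := by
  have hr0 : 0 < r := lt_of_lt_of_le (by positivity) hr
  rw [radialLift, if_neg (not_le.2 hr0)]
  have h2 : log (R ^ 2) - log r ≤ ε := by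
    have := log_le_log (by positivity) hr
    rw [log_mul (by positivity) (exp_pos _).ne', log_exp] at this
    linarith
  rw [intervalIntegral.integral_congr (g := fun _ => 0)]
  · simp
  · intro s hs
    refine hε s (hs.2.trans ?_)
    exact max_le hε0.le h2

theorem isTestFun_radialLift (hφ : ContDiff ℝ (⊤ : ℕ∞) φ) (hR : 0 < R)
    (hS : ∀ s, S ≤ s → φ s = 0) (hε : ∀ s, s ≤ ε → φ s = 0) (hε0 : 0 < ε) :
    ContDiff ℝ (⊤ : ℕ∞) (fun x : E2 => radialLift φ R S (‖x‖ ^ 2)) ∧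
    IsCompact (tsupport fun x : E2 => radialLift φ R S (‖x‖ ^ 2)) ∧
    (tsupport fun x : E2 => radialLift φ R S (‖x‖ ^ 2)) ⊆ Metric.ball 0 R := by
  have hsub : (tsupport fun x : E2 => radialLift φ R S (‖x‖ ^ 2)) ⊆
      Metric.closedBall 0 (R * exp (-ε / 2)) := by
    refine closure_minimal ?_ Metric.isClosed_closedBall
    intro x hx
    rw [mem_closedBall_zero_iff]
    by_contra h
    push Not at h
    apply hx
    refine radialLift_eq_zero hε hε0 hR ?_
    have e : R ^ 2 * exp (-ε) = (R * exp (-ε / 2)) ^ 2 := by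
      rw [mul_pow, ← exp_nat_mul]; congr 2; push_cast; ring
    rw [e]
    exact pow_le_pow_left₀ (by positivity) h.le 2
  refine ⟨(contDiff_radialLift hφ hR hS).comp (contDiff_norm_sq ℝ),
    (isCompact_closedBall _ _).of_isClosed_subset (isClosed_tsupport _) hsub,
    hsub.trans (Metric.closedBall_subset_ball ?_)⟩
  have : exp (-ε / 2) < 1 := exp_lt_one_iff.2 (by linarith)
  nlinarith

theorem norm_fderiv_radialLift_sq (hφ : ContDiff ℝ (⊤ : ℕ∞) φ) {x : E2} (hx : x ≠ 0) :
    ‖fderiv ℝ (fun x : E2 => radialLift φ R S (‖x‖ ^ 2)) x‖ ^ 2 =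
      4 * φ (log (R ^ 2) - log (‖x‖ ^ 2)) ^ 2 / ‖x‖ ^ 2 := by
  have hx0 : 0 < ‖x‖ := norm_pos_iff.2 hx
  set r := ‖x‖ ^ 2 with hr
  have hr0 : 0 < r := by positivity
  have h1 : HasDerivAt (fun s => ∫ x in 0..s, φ x) (φ (log (R ^ 2) - log r))
      (log (R ^ 2) - log r) :=
    intervalIntegral.integral_hasDerivAt_right (hφ.continuous.intervalIntegrable _ _)
      hφ.continuous.stronglyMeasurable.stronglyMeasurableAtFilter hφ.continuous.continuousAt
  have h2 : HasDerivAt (fun r => log (R ^ 2) - log r) (-r⁻¹) r := by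
    exact (hasDerivAt_log hr0.ne').const_sub (log (R ^ 2))
  have h3 : HasDerivAt (radialLift φ R S) (φ (log (R ^ 2) - log r) * (-r⁻¹)) r := by
    refine (h1.comp r h2).congr_of_eventuallyEq ?_
    filter_upwards [lt_mem_nhds hr0] with y hy
    rw [radialLift, if_neg (not_le.2 hy)]
    rfl
  have h4 : HasFDerivAt (fun x : E2 => ‖x‖ ^ 2) (2 • innerSL ℝ x) x :=
    (hasStrictFDerivAt_norm_sq x).hasFDerivAt
  have h5 := (h3.comp_hasFDerivAt x h4).fderiv
  change ‖fderiv ℝ (radialLift φ R S ∘ fun x : E2 => ‖x‖ ^ 2) x‖ ^ 2 = _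
  rw [h5, norm_smul, ← Nat.cast_smul_eq_nsmul ℝ, norm_smul, innerSL_apply_norm, mul_pow, mul_pow,
    ← hr]
  simp only [Real.norm_eq_abs, sq_abs]
  field_simp
  norm_num

end Lift

end RadialLift

section SmoothPoincare

open scoped Pointwise Topology

section Lift

variable {φ : ℝ → ℝ} {R S ε : ℝ}

theorem setIntegral_ball_log {R : ℝ} (hR : 0 < R) {H : ℝ → ℝ} (hH : Measurable H) :
    ∫ x in Metric.ball (0 : E2) R, H (log (R ^ 2) - log (‖x‖ ^ 2)) =
      π * R ^ 2 * ∫ s, H s ∂expM := by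
  have hm : Measurable fun x : E2 => log (R ^ 2) - log (‖x‖ ^ 2) := by fun_prop
  rw [← integral_map (φ := fun x : E2 => log (R ^ 2) - log (‖x‖ ^ 2)) hm.aemeasurable
    hH.aestronglyMeasurable, map_log_ball hR, integral_smul_measure,
    ENNReal.toReal_ofReal (by positivity), smul_eq_mul]

theorem poincare_of_smooth {p l : ℝ} (hR : 0 < R)
    (hl : ∀ f : E2 → ℝ, ContDiff ℝ (⊤ : ℕ∞) f → IsCompact (tsupport f) →
      tsupport f ⊆ Metric.ball 0 R →
      l * (∫ x in Metric.ball 0 R, |f x| ^ p) ^ (2 / p) ≤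
        ∫ x in Metric.ball 0 R, ‖fderiv ℝ f x‖ ^ 2)
    (hφ : ContDiff ℝ (⊤ : ℕ∞) φ) (hS : ∀ s, S ≤ s → φ s = 0) (hε : ∀ s, s ≤ ε → φ s = 0)
    (hε0 : 0 < ε) :
    l * (π * R ^ 2) ^ (2 / p) / (4 * π) * (∫ s, |∫ x in 0..s, φ x| ^ p ∂expM) ^ (2 / p) ≤
      ∫ x, φ x ^ 2 := by
  obtain ⟨h1, h2, h3⟩ := isTestFun_radialLift hφ hR hS hε hε0
  have key := hl _ h1 h2 h3
  have hne : ∀ᵐ x : E2 ∂(volume.restrict (Metric.ball 0 R)), x ≠ 0 := by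
    apply ae_restrict_of_ae
    rw [ae_iff]; simp
  have e1 : ∫ x in Metric.ball (0 : E2) R, |radialLift φ R S (‖x‖ ^ 2)| ^ p =
      π * R ^ 2 * ∫ s, |∫ x in 0..s, φ x| ^ p ∂expM := by
    rw [← setIntegral_ball_log hR]
    · refine integral_congr_ae ?_
      filter_upwards [hne] with x hx
      have hx0 : 0 < ‖x‖ ^ 2 := by have := norm_pos_iff.2 hx; positivity
      rw [radialLift, if_neg (not_le.2 hx0)]
    · exact ((contDiff_primitive hφ).continuous.measurable.abs).pow_const p
  have e2 : ∫ x in Metric.ball (0 : E2) R,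
      ‖fderiv ℝ (fun x : E2 => radialLift φ R S (‖x‖ ^ 2)) x‖ ^ 2 = 4 * π * ∫ x, φ x ^ 2 := by
    have e3 : ∫ x in Metric.ball (0 : E2) R,
        ‖fderiv ℝ (fun x : E2 => radialLift φ R S (‖x‖ ^ 2)) x‖ ^ 2 =
        π * R ^ 2 * ∫ s, 4 * φ s ^ 2 * exp s / R ^ 2 ∂expM := by
      have hφc := hφ.continuous.measurable
      rw [← setIntegral_ball_log hR (by fun_prop)]
      refine integral_congr_ae ?_
      filter_upwards [hne] with x hx
      have hx0 : 0 < ‖x‖ := norm_pos_iff.2 hx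
      rw [norm_fderiv_radialLift_sq hφ hx, exp_sub, exp_log (by positivity), exp_log (by positivity)]
      field_simp
    rw [e3, integral_expM]
    have e4 : ∫ t in Ioi (0 : ℝ), exp (-t) * (4 * φ t ^ 2 * exp t / R ^ 2) =
        4 / R ^ 2 * ∫ x, φ x ^ 2 := by
      rw [← integral_const_mul, ← integral_indicator measurableSet_Ioi]
      congr 1
      ext t
      by_cases ht : t ∈ Ioi (0 : ℝ)
      · rw [indicator_of_mem ht]
        have : exp (-t) * exp t = 1 := by rw [← exp_add]; simp
        linear_combination (4 * φ t ^ 2 / R ^ 2) * this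
      · rw [indicator_of_notMem ht, hε t (by rw [mem_Ioi] at ht; linarith)]
        simp
    rw [e4]
    field_simp
  rw [e1, e2] at key
  have i0 : 0 ≤ ∫ s, |∫ x in 0..s, φ x| ^ p ∂expM := integral_nonneg fun s => by positivity
  rw [mul_rpow (by positivity) i0] at key
  rw [div_mul_eq_mul_div, div_le_iff₀ (by positivity)]
  linarith

end Lift

/-- Square-integrable functions vanishing on the nonpositive half-line are `L²` limits of smooth
functions supported in compact subsets of the positive half-line. -/
theorem exists_smooth_approx {ψ : ℝ → ℝ} (hψ : MemLp ψ 2 volume) (h0 : ∀ s, s ≤ 0 → ψ s = 0)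
    {δ : ℝ} (hδ : 0 < δ) :
    ∃ φ : ℝ → ℝ, ∃ ε S : ℝ, 0 < ε ∧ ContDiff ℝ (⊤ : ℕ∞) φ ∧ (∀ s, s ≤ ε → φ s = 0) ∧
      (∀ s, S ≤ s → φ s = 0) ∧ MemLp φ 2 volume ∧ ∫ s, (φ s - ψ s) ^ 2 ≤ δ := by
  obtain ⟨g, hgc, hg, hgδ⟩ := hψ.exist_eLpNorm_sub_le (by simp) (by norm_num)
    (ε := √(δ / 4)) (by positivity)
  have hgL : MemLp g 2 volume := hg.continuous.memLp_of_hasCompactSupport hgc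
  have hg2 : ∫ s, (ψ s - g s) ^ 2 ≤ δ / 4 := by
    have hd := hψ.sub hgL
    rw [hd.eLpNorm_eq_integral_rpow_norm (by simp) (by simp)] at hgδ
    have := (ENNReal.ofReal_le_ofReal_iff (sqrt_nonneg _)).1 hgδ
    simp only [ENNReal.toReal_ofNat, rpow_ofNat, Pi.sub_apply, norm_eq_abs, sq_abs] at this
    have hn : 0 ≤ ∫ s, (ψ s - g s) ^ 2 := integral_nonneg fun s => sq_nonneg _
    rw [show (2 : ℝ)⁻¹ = 1 / 2 by norm_num, ← sqrt_eq_rpow] at this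
    exact (sqrt_le_sqrt_iff (by positivity)).1 this
  let χ : ℕ → ℝ → ℝ := fun m s => smoothTransition ((m + 1 : ℝ) * s - 1)
  have hχ : ∀ m, ContDiff ℝ (⊤ : ℕ∞) (χ m) := fun m =>
    smoothTransition.contDiff.comp ((contDiff_const.mul contDiff_id).sub contDiff_const)
  have hχ0 : ∀ m s, 0 ≤ χ m s := fun m s => smoothTransition.nonneg _
  have hχ1 : ∀ m s, χ m s ≤ 1 := fun m s => smoothTransition.le_one _
  have hψ2 : Integrable (fun s => ψ s ^ 2) := hψ.integrable_sq
  have hlim : Tendsto (fun m => ∫ s, ((1 - χ m s) * ψ s) ^ 2) atTop (𝓝 (∫ _ : ℝ, (0 : ℝ))) := by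
    refine tendsto_integral_of_dominated_convergence (fun s => ψ s ^ 2) ?_ hψ2 ?_ ?_
    · intro m
      exact ((continuous_const.sub (hχ m).continuous).aestronglyMeasurable.mul hψ.1).pow 2
    · intro m
      refine ae_of_all _ fun s => ?_
      rw [norm_of_nonneg (sq_nonneg _), mul_pow]
      have : (1 - χ m s) ^ 2 ≤ 1 := by
        have := hχ0 m s; have := hχ1 m s; nlinarith
      nlinarith [sq_nonneg (ψ s)]
    · refine ae_of_all _ fun s => ?_
      rcases le_or_gt s 0 with hs | hs
      · simp [h0 s hs]
      · obtain ⟨N, hN⟩ := exists_nat_ge (2 / s)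
        refine tendsto_const_nhds.congr' ?_
        filter_upwards [eventually_ge_atTop N] with m hm
        have h1 : 1 ≤ (m + 1 : ℝ) * s - 1 := by
          have h2 : (N : ℝ) ≤ m := by exact_mod_cast hm
          have h3 : 2 ≤ m * s := by rw [← div_le_iff₀ hs]; linarith
          linarith
        simp [χ, smoothTransition.one_of_one_le h1]
  rw [integral_zero] at hlim
  obtain ⟨m, hm⟩ := (hlim.eventually (gt_mem_nhds (show (0 : ℝ) < δ / 4 by positivity))).exists
  obtain ⟨S, hS⟩ := hgc.isCompact.bddAbove
  have hφc : ContDiff ℝ (⊤ : ℕ∞) fun s => χ m s * g s := (hχ m).mul hg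
  have hφL : MemLp (fun s => χ m s * g s) 2 volume :=
    hφc.continuous.memLp_of_hasCompactSupport hgc.mul_left
  refine ⟨fun s => χ m s * g s, 1 / (m + 1 : ℝ), S + 1, by positivity, hφc, ?_, ?_, hφL, ?_⟩
  · intro s hs
    have : (m + 1 : ℝ) * s - 1 ≤ 0 := by
      rw [le_div_iff₀ (by positivity)] at hs; linarith
    simp [χ, smoothTransition.zero_of_nonpos this]
  · intro s hs
    have : s ∉ tsupport g := fun h => by linarith [hS h]
    simp [image_eq_zero_of_notMem_tsupport this]
  · have hi1 : Integrable fun s => (ψ s - g s) ^ 2 := (hψ.sub hgL).integrable_sq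
    have hi2 : Integrable fun s => ((1 - χ m s) * ψ s) ^ 2 := by
      refine hψ2.mono (((continuous_const.sub (hχ m).continuous).aestronglyMeasurable.mul
        hψ.1).pow 2) (ae_of_all _ fun s => ?_)
      rw [norm_of_nonneg (sq_nonneg _), norm_of_nonneg (sq_nonneg _), mul_pow]
      have : (1 - χ m s) ^ 2 ≤ 1 := by
        have := hχ0 m s; have := hχ1 m s; nlinarith
      nlinarith [sq_nonneg (ψ s)]
    calc ∫ s, (χ m s * g s - ψ s) ^ 2 ≤
          ∫ s, (2 * (ψ s - g s) ^ 2 + 2 * ((1 - χ m s) * ψ s) ^ 2) := by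
          refine integral_mono (hφL.sub hψ).integrable_sq ((hi1.const_mul 2).add (hi2.const_mul 2))
            fun s => ?_
          simp only
          have : χ m s * g s - ψ s = -(χ m s * (ψ s - g s)) - (1 - χ m s) * ψ s := by ring
          rw [this]
          have h2 : (χ m s) ^ 2 ≤ 1 := by
            have := hχ0 m s; have := hχ1 m s; nlinarith
          have h3 : (χ m s * (ψ s - g s)) ^ 2 ≤ (ψ s - g s) ^ 2 := by
            rw [mul_pow]; nlinarith [sq_nonneg (ψ s - g s)]
          nlinarith [sq_nonneg (-(χ m s * (ψ s - g s)) + (1 - χ m s) * ψ s)]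
      _ = 2 * (∫ s, (ψ s - g s) ^ 2) + 2 * ∫ s, ((1 - χ m s) * ψ s) ^ 2 := by
          rw [integral_add (hi1.const_mul 2) (hi2.const_mul 2), integral_const_mul,
            integral_const_mul]
      _ ≤ δ := by linarith

end SmoothPoincare

section Density

open scoped Pointwise Topology

theorem sq_primitive_le {f : ℝ → ℝ} (hf : MemLp f 2 volume) {s : ℝ} (hs : 0 ≤ s) :
    (∫ x in 0..s, f x) ^ 2 ≤ s * ∫ x, f x ^ 2 := by
  have h1 : IntegrableOn f (Ioc 0 s) := (hf.restrict _).integrable one_le_two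
  rw [intervalIntegral.integral_of_le hs]
  refine (sq_setIntegral_le h1 hf.integrable_sq.integrableOn (by simp)).trans ?_
  rw [Real.volume_Ioc, sub_zero, ENNReal.toReal_ofReal hs]
  exact mul_le_mul_of_nonneg_left (setIntegral_le_integral hf.integrable_sq
    (ae_of_all _ fun x => sq_nonneg _)) hs

theorem integrable_sqrt_rpow_expM {p : ℝ} (hp : 0 < p) (B : ℝ) :
    Integrable (fun s => √(s * B) ^ p) expM := by
  have h := (memLp_id_expM (p := p / 2) (by positivity)).integrable_norm_rpow (by simpa using hp)
    ENNReal.ofReal_ne_top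
  rw [ENNReal.toReal_ofReal (by positivity)] at h
  refine (h.const_mul (√B ^ p)).congr ?_
  filter_upwards [ae_expM_pos] with s hs
  rw [sqrt_mul hs.le, mul_rpow (sqrt_nonneg _) (sqrt_nonneg _), norm_of_nonneg hs.le, mul_comm,
    sqrt_eq_rpow s, ← rpow_mul hs.le]
  ring_nf

theorem expPoincare_of_smooth {p Λ : ℝ} (hp : 0 < p)
    (h : ∀ (φ : ℝ → ℝ) (ε S : ℝ), 0 < ε → ContDiff ℝ (⊤ : ℕ∞) φ → (∀ s, s ≤ ε → φ s = 0) →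
      (∀ s, S ≤ s → φ s = 0) →
      Λ * (∫ s, |∫ x in 0..s, φ x| ^ p ∂expM) ^ (2 / p) ≤ ∫ x, φ x ^ 2) :
    ExpPoincare Λ p := by
  intro ψ t ht hψ hψ0
  have happ : ∀ n : ℕ, ∃ φ : ℝ → ℝ, ContDiff ℝ (⊤ : ℕ∞) φ ∧ MemLp φ 2 volume ∧
      ∫ s, (φ s - ψ s) ^ 2 ≤ (1 / (n + 1 : ℝ)) ^ 2 ∧
      Λ * (∫ s, |∫ x in 0..s, φ x| ^ p ∂expM) ^ (2 / p) ≤ ∫ x, φ x ^ 2 := by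
    intro n
    obtain ⟨φ, ε, S, hε, hφ, h1, h2, h3, h4⟩ := exists_smooth_approx hψ
      (fun s hs => hψ0 s fun h => not_lt.2 hs h.1)
      (show 0 < (1 / (n + 1 : ℝ)) ^ 2 by positivity)
    exact ⟨φ, hφ, h3, h4, h φ ε S hε hφ h1 h2⟩
  choose φ hφ hφL hφψ hφP using happ
  let d : ℕ → ℝ := fun n => 1 / (n + 1 : ℝ)
  have hd0 : ∀ n, 0 < d n := fun n => by simp only [d]; positivity
  have hd1 : ∀ n, d n ≤ 1 := fun n => by
    simp only [d]; rw [div_le_one (by positivity)]; linarith [Nat.cast_nonneg (α := ℝ) n]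
  have hdlim : Tendsto d atTop (𝓝 0) := tendsto_one_div_add_atTop_nhds_zero_nat
  set I := ∫ x, ψ x ^ 2 with hI
  have hI0 : 0 ≤ I := integral_nonneg fun s => sq_nonneg _
  have hsq : ∀ n, ∫ x, φ n x ^ 2 ≤ (1 + d n) * I + (1 + d n) * d n := by
    intro n
    have hi := ((hφL n).sub hψ).integrable_sq
    calc ∫ x, φ n x ^ 2 ≤ ∫ x, ((1 + d n) * ψ x ^ 2 + (1 + 1 / d n) * (φ n x - ψ x) ^ 2) := by
          refine integral_mono (hφL n).integrable_sq ((hψ.integrable_sq.const_mul _).add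
            (hi.const_mul _)) fun x => ?_
          simp only
          have : 0 ≤ (d n * ψ x - (φ n x - ψ x)) ^ 2 / d n := by
            have := hd0 n; positivity
          have e : (d n * ψ x - (φ n x - ψ x)) ^ 2 / d n = d n * ψ x ^ 2
              - 2 * ψ x * (φ n x - ψ x) + 1 / d n * (φ n x - ψ x) ^ 2 := by
            have := (hd0 n).ne'
            field_simp
            ring
          linarith [e]
      _ = (1 + d n) * I + (1 + 1 / d n) * ∫ x, (φ n x - ψ x) ^ 2 := by
          have := integral_add (hψ.integrable_sq.const_mul (1 + d n)) (hi.const_mul (1 + 1 / d n))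
          rw [integral_const_mul, integral_const_mul] at this
          exact this
      _ ≤ (1 + d n) * I + (1 + 1 / d n) * d n ^ 2 := by
          have := hd0 n
          gcongr
          exact hφψ n
      _ = (1 + d n) * I + (1 + d n) * d n := by
          have := (hd0 n).ne'
          field_simp
          ring
  set B := 2 * I + 2 with hB
  have hsqB : ∀ n, ∫ x, φ n x ^ 2 ≤ B := by
    intro n
    refine (hsq n).trans ?_
    have := hd0 n; have := hd1 n
    nlinarith
  have hlimP : ∀ s, 0 < s → Tendsto (fun n => ∫ x in 0..s, φ n x) atTop
      (𝓝 (∫ x in 0..s, ψ x)) := by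
    intro s hs
    rw [tendsto_iff_dist_tendsto_zero]
    refine squeeze_zero (fun _ => dist_nonneg) (g := fun n => √s * d n) (fun n => ?_) ?_
    · have h1 := sq_primitive_le ((hφL n).sub hψ) hs.le
      have i1 : IntervalIntegrable (φ n) volume 0 s := (hφ n).continuous.intervalIntegrable _ _
      have i2 : IntervalIntegrable ψ volume 0 s := by
        rw [intervalIntegrable_iff_integrableOn_Ioc_of_le hs.le]
        exact (hψ.restrict _).integrable one_le_two
      simp only [Pi.sub_apply] at h1
      rw [intervalIntegral.integral_sub i1 i2] at h1
      rw [Real.dist_eq]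
      refine (abs_le_sqrt (h1.trans (mul_le_mul_of_nonneg_left (hφψ n) hs.le))).trans_eq ?_
      rw [sqrt_mul hs.le, sqrt_sq (hd0 n).le]
    · simpa using hdlim.const_mul (√s)
  have hlimI : Tendsto (fun n => ∫ s, |∫ x in 0..s, φ n x| ^ p ∂expM) atTop
      (𝓝 (∫ s, |∫ x in 0..s, ψ x| ^ p ∂expM)) := by
    refine tendsto_integral_of_dominated_convergence (fun s => √(s * B) ^ p) ?_
      (integrable_sqrt_rpow_expM hp B) ?_ ?_
    · intro n
      exact (((contDiff_primitive (hφ n)).continuous.measurable.abs).pow_const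
        p).aestronglyMeasurable
    · intro n
      filter_upwards [ae_expM_pos] with s hs
      rw [norm_of_nonneg (by positivity)]
      refine rpow_le_rpow (abs_nonneg _) (abs_le_sqrt ?_) hp.le
      exact (sq_primitive_le (hφL n) hs.le).trans (mul_le_mul_of_nonneg_left (hsqB n) hs.le)
    · filter_upwards [ae_expM_pos] with s hs
      exact ((hlimP s hs).abs).rpow_const (Or.inr hp.le)
  have hR : Tendsto (fun n => (1 + d n) * I + (1 + d n) * d n) atTop (𝓝 I) := by
    have h1 := (tendsto_const_nhds (x := (1 : ℝ))).add hdlim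
    simpa using (h1.mul_const I).add (h1.mul hdlim)
  exact le_of_tendsto_of_tendsto' ((hlimI.rpow_const (Or.inr (by positivity))).const_mul Λ) hR
    fun n => (hφP n).trans (hsq n)

end Density

theorem lambdaP_nonneg (Ω : Set E2) (p : ℝ) : 0 ≤ lambdaP Ω p := by
  refine Real.sInf_nonneg ?_
  rintro c ⟨u, -, -, rfl⟩
  exact integral_nonneg fun x => sq_nonneg _

theorem lambdaP_mul_le {Ω : Set E2} {p : ℝ} (hp : 0 < p) {f : E2 → ℝ}
    (hf : IsTestFun (symDisk Ω) f) :
    lambdaP Ω p * (∫ x in symDisk Ω, |f x| ^ p) ^ (2 / p) ≤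
      ∫ x in symDisk Ω, ‖fderiv ℝ f x‖ ^ 2 := by
  obtain ⟨h1, h2, h3⟩ := hf
  have hI0 : 0 ≤ ∫ x in symDisk Ω, |f x| ^ p := integral_nonneg fun x => by positivity
  have hJ0 : 0 ≤ ∫ x in symDisk Ω, ‖fderiv ℝ f x‖ ^ 2 := integral_nonneg fun x => by positivity
  rcases hI0.eq_or_lt with hI | hI
  · rw [← hI, zero_rpow (by positivity), mul_zero]
    exact hJ0
  · set I := ∫ x in symDisk Ω, |f x| ^ p
    set J := ∫ x in symDisk Ω, ‖fderiv ℝ f x‖ ^ 2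
    set N := I ^ (1 / p) with hN
    have hN0 : 0 < N := by positivity
    have hNp : N ^ p = I := by rw [hN, ← rpow_mul hI.le, one_div_mul_cancel hp.ne', rpow_one]
    have hle : lambdaP Ω p ≤ N⁻¹ ^ 2 * J := by
      refine csInf_le ⟨0, ?_⟩ ⟨fun x => N⁻¹ * f x, ⟨contDiff_const.mul h1, ?_, ?_⟩, ?_, ?_⟩
      · rintro c ⟨u, -, -, rfl⟩
        exact integral_nonneg fun x => sq_nonneg _
      · exact (HasCompactSupport.mul_left (f := fun _ => N⁻¹) (show HasCompactSupport f from h2))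
      · exact (tsupport_mul_subset_right (f := fun _ => N⁻¹) (g := f)).trans h3
      · have e : ∀ x, |N⁻¹ * f x| ^ p = (N⁻¹) ^ p * |f x| ^ p := by
          intro x
          rw [abs_mul, abs_of_pos (inv_pos.2 hN0), mul_rpow (inv_pos.2 hN0).le (abs_nonneg _)]
        simp only [e]
        rw [integral_const_mul, inv_rpow hN0.le, hNp, inv_mul_cancel₀ hI.ne', one_rpow]
      · have e : ∀ x, ‖fderiv ℝ (fun x => N⁻¹ * f x) x‖ ^ 2 = N⁻¹ ^ 2 * ‖fderiv ℝ f x‖ ^ 2 := by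
          intro x
          rw [fderiv_const_mul ((h1.differentiable (by simp)) x), norm_smul, mul_pow,
            norm_of_nonneg (inv_pos.2 hN0).le]
        simp only [e]
        rw [integral_const_mul]
    rw [rpow_two_div hI.le, ← hN]
    calc lambdaP Ω p * N ^ 2 ≤ N⁻¹ ^ 2 * J * N ^ 2 := by gcongr
      _ = J := by field_simp

theorem expPoincare_lambdaP {Ω : Set E2} (hA : 0 < (volume Ω).toReal) {p : ℝ} (hp : 0 < p) :
    ExpPoincare (lambdaP Ω p * (volume Ω).toReal ^ (2 / p) / (4 * π)) p := by
  set R := √((volume Ω).toReal / π) with hR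
  have hR0 : 0 < R := sqrt_pos.2 (by positivity)
  have hRA : π * R ^ 2 = (volume Ω).toReal := by
    rw [hR, sq_sqrt (by positivity)]; field_simp
  refine expPoincare_of_smooth hp fun φ ε S hε hφ h1 h2 => ?_
  rw [← hRA]
  refine poincare_of_smooth hR0 (fun f hf1 hf2 hf3 => ?_) hφ h2 h1 hε
  exact lambdaP_mul_le hp ⟨hf1, hf2, hf3⟩

theorem setLIntegral_abs_eq {u : E2 → ℝ} {Ω : Set E2} (hu : Continuous u)
    (hc : HasCompactSupport u) (hΩ : volume Ω ≠ ∞) (hA : 0 < (volume Ω).toReal)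
    (hsub : tsupport u ⊆ Ω) {g : ℝ → ℝ≥0∞} (hg : Measurable g) :
    ∫⁻ x in Ω, g |u x| =
      volume Ω * ∫⁻ s, g (logRearrangement u (volume Ω).toReal s) ∂expM := by
  rw [← lintegral_map (g := fun x => |u x|) hg hu.measurable.abs,
    ← map_logRearrangement hu hc hΩ hA hsub,
    lintegral_map hg (logRearrangement_mono hu hc hA).measurable, lintegral_smul_measure]
  rfl

theorem setIntegral_abs_eq {u : E2 → ℝ} {Ω : Set E2} (hu : Continuous u)
    (hc : HasCompactSupport u) (hΩ : volume Ω ≠ ∞) (hA : 0 < (volume Ω).toReal)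
    (hsub : tsupport u ⊆ Ω) {g : ℝ → ℝ} (hg : Measurable g) :
    ∫ x in Ω, g |u x| =
      (volume Ω).toReal * ∫ s, g (logRearrangement u (volume Ω).toReal s) ∂expM := by
  rw [← integral_map (φ := fun x => |u x|) hu.measurable.abs.aemeasurable hg.aestronglyMeasurable,
    ← map_logRearrangement hu hc hΩ hA hsub,
    integral_map (logRearrangement_mono hu hc hA).measurable.aemeasurable hg.aestronglyMeasurable,
    integral_smul_measure]
  rfl

/-- For a bounded domain `Ω ⊆ ℝ²`, `2 < p < ∞` and `λ < λ_p`, the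
Trudinger-Moser supremum under the constraint `∫|∇u|² - λ‖u‖_p² ≤ 1` is finite. -/
theorem trudinger_moser_Lp_remainder (Ω : Set E2) (hne : Ω.Nonempty) (hO : IsOpen Ω)
    (hb : Bornology.IsBounded Ω) (p lam : ℝ) (hp : 2 < p) (hlam : lam < lambdaP Ω p) :
    ∃ C : ℝ, ∀ u : E2 → ℝ, IsTestFun Ω u →
      (∫ x in Ω, ‖fderiv ℝ u x‖ ^ 2) - lam * (∫ x in Ω, |u x| ^ p) ^ (2 / p) ≤ 1 →
      (∫ x in Ω, Real.exp (4 * π * u x ^ 2)) ≤ C := by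
  have hp0 : 0 < p := by linarith
  have hΩ : volume Ω ≠ ∞ := hb.measure_lt_top.ne
  have hA : 0 < (volume Ω).toReal := ENNReal.toReal_pos (hO.measure_pos volume hne).ne' hΩ
  set A := (volume Ω).toReal with hAdef
  have hl0 := lambdaP_nonneg Ω p
  obtain ⟨θ, hθ0, hθ1, hθ⟩ : ∃ θ : ℝ, 0 ≤ θ ∧ θ < 1 ∧ lam ≤ θ * lambdaP Ω p := by
    rcases le_or_gt lam 0 with h | h
    · exact ⟨0, le_rfl, one_pos, by linarith⟩
    · have hl1 := h.trans hlam
      exact ⟨lam / lambdaP Ω p, by positivity, (div_lt_one hl1).2 hlam,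
        by rw [div_mul_cancel₀ _ hl1.ne']⟩
  set Λ := lambdaP Ω p * A ^ (2 / p) / (4 * π) with hΛ
  have hΛ0 : 0 ≤ Λ := by positivity
  obtain ⟨C, hC, hCb⟩ := exists_energy_defect_bound (by linarith) hΛ0
    (expPoincare_lambdaP hA hp0) hθ0 hθ1
  obtain ⟨B, hB, hBb⟩ := exists_lintegral_exp_sq_le hC
  refine ⟨A * B, fun u hu hcon => ?_⟩
  obtain ⟨hus, huc, hsub⟩ := hu
  have huc' : HasCompactSupport u := huc
  have hucont := hus.continuous
  let w : ℝ → ℝ := fun t => √(4 * π) * logRearrangement u A t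
  have hw : Monotone w := (logRearrangement_mono hucont huc' hA).const_mul (sqrt_nonneg _)
  have hwn : ∀ t, 0 ≤ w t := fun t => mul_nonneg (sqrt_nonneg _) (logRearrangement_nonneg t)
  have hw0 : ∀ t ≤ 0, w t = 0 := fun t ht => le_antisymm
    ((hw ht).trans_eq (by simp only [w]; rw [logRearrangement_zero hucont huc' hΩ hA hsub, mul_zero]))
    (hwn t)
  have hF := energyBelow_mono hus huc' hA
  have hF0 : ∀ t, 0 ≤ energyBelow u A t := energyBelow_nonneg
  have hFE := energyBelow_le (A := A) hus huc'
  have hinc : ∀ a b, a ≤ b →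
      (w b - w a) ^ 2 ≤ (b - a) * (energyBelow u A b - energyBelow u A a) := by
    intro a b hab
    refine sq_sub_le_of_exp (fun a b hab => ?_) hab
    refine le_of_eq_of_le ?_ (logRearrangement_increment hus huc' hA hab)
    simp only [w]
    rw [← mul_sub, mul_pow, sq_sqrt (by positivity)]
  have hEΩ : ∫ x in Ω, ‖fderiv ℝ u x‖ ^ 2 = ∫ x, ‖fderiv ℝ u x‖ ^ 2 := by
    refine setIntegral_eq_integral_of_forall_compl_eq_zero fun x hx => ?_
    have : fderiv ℝ u x = 0 :=
      image_eq_zero_of_notMem_tsupport fun h => hx (hsub (tsupport_fderiv_subset ℝ h))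
    simp [this]
  have hX0 : 0 ≤ ∫ x in Ω, |u x| ^ p := integral_nonneg fun x => by positivity
  have hα : Λ * (∫ s, |w s| ^ p ∂expM) ^ (2 / p) =
      lambdaP Ω p * (∫ x in Ω, |u x| ^ p) ^ (2 / p) := by
    have hm : Measurable fun y : ℝ => |y| ^ p := by fun_prop
    have e1 := setIntegral_abs_eq hucont huc' hΩ hA hsub hm
    simp only [abs_abs] at e1
    rw [e1, ← hAdef]
    have e2 : ∀ s, |w s| ^ p = (4 * π) ^ (p / 2) * |logRearrangement u A s| ^ p := by
      intro s
      simp only [w]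
      rw [abs_mul, abs_of_nonneg (sqrt_nonneg _), mul_rpow (sqrt_nonneg _) (abs_nonneg _),
        sqrt_eq_rpow, ← rpow_mul (by positivity)]
      ring_nf
    simp only [e2]
    have i0 : 0 ≤ ∫ s, |logRearrangement u A s| ^ p ∂expM :=
      integral_nonneg fun x => by positivity
    rw [integral_const_mul, mul_rpow (by positivity) i0, mul_rpow hA.le i0,
      ← rpow_mul (by positivity), show p / 2 * (2 / p) = 1 by field_simp, rpow_one, hΛ]
    field_simp
  have hE1 : ∫ x, ‖fderiv ℝ u x‖ ^ 2 ≤ 1 + θ * Λ * (∫ s, |w s| ^ p ∂expM) ^ (2 / p) := by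
    rw [mul_assoc, hα, ← mul_assoc, ← hEΩ]
    have : lam * (∫ x in Ω, |u x| ^ p) ^ (2 / p) ≤
        θ * lambdaP Ω p * (∫ x in Ω, |u x| ^ p) ^ (2 / p) := by gcongr
    linarith
  have hd := hCb w (energyBelow u A) _ hw hw0 hF hF0 hFE hinc hE1
  have hfin := hBb w (energyBelow u A) _ hw hFE hinc hd
  have hg : Measurable fun y : ℝ => ENNReal.ofReal (exp (4 * π * y ^ 2)) := by fun_prop
  have e := setLIntegral_abs_eq hucont huc' hΩ hA hsub hg
  simp only [sq_abs] at e
  rw [integral_eq_lintegral_of_nonneg_ae (ae_of_all _ fun x => (exp_pos _).le)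
    (by fun_prop), e]
  refine ENNReal.toReal_le_of_le_ofReal (by positivity) ?_
  rw [ENNReal.ofReal_mul hA.le, hAdef, ENNReal.ofReal_toReal hΩ]
  refine mul_le_mul_right (le_trans (le_of_eq ?_) hfin) _
  refine lintegral_congr fun s => ?_
  simp only [w]
  rw [mul_pow, sq_sqrt (by positivity)]
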